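/- arXiv:1101.4255 — 11 statements merged into one kernel-verified Lean document; each statement's English description precedes it below -/
import Mathlib

section
/- Let p1 < p2 be odd primes. Then the maximum gap of the cyclotomic polynomial Φ_{p1·p2} satisfies g(Φ_{p1p2}) = p1 - 1. -/
open Polynomial

/-- The maximum gap `g(f)` between consecutive exponents occurring in a polynomial:
for `f = c₁x^{e₁} + ⋯ + cₜx^{eₜ}` with `cᵢ ≠ 0` and `e₁ < ⋯ < eₜ`, this is
`max_{1 ≤ i < t} (e_{i+1} - e_i)`, and `0` when `t = 1`. -/
noncomputable def maxGap (f : Polynomial ℤ) : ℕ :=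
  (((f.support.sort (· ≤ ·)).zip (f.support.sort (· ≤ ·)).tail).map
    (fun p => p.2 - p.1)).foldr max 0

theorem List.foldr_max_zero_le_iff (l : List ℕ) (m : ℕ) :
    l.foldr max 0 ≤ m ↔ ∀ x ∈ l, x ≤ m := by
  induction l with
  | nil => simp
  | cons a t ih => simp [ih]

theorem List.mem_zip_tail_iff {l : List ℕ} (hl : l.Pairwise (· < ·)) (a b : ℕ) :
    (a, b) ∈ l.zip l.tail ↔ a ∈ l ∧ b ∈ l ∧ a < b ∧ ∀ c ∈ l, a < c → b ≤ c := by
  induction l with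
  | nil => simp
  | cons x t ih =>
    cases t with
    | nil => simp; omega
    | cons y t =>
      have ih := ih hl.of_cons
      simp only [List.tail_cons] at ih
      simp only [List.tail_cons, List.zip_cons_cons, List.mem_cons, Prod.mk.injEq] at ih ⊢
      rw [ih]
      simp only [List.pairwise_cons, List.mem_cons] at hl
      obtain ⟨hx, hy, -⟩ := hl
      have hxy := hx y (.inl rfl)
      constructor
      · rintro (⟨rfl, rfl⟩ | ⟨ha, hb, hab, hc⟩)
        · refine ⟨.inl rfl, .inr (.inl rfl), hxy, ?_⟩
          rintro c (rfl | rfl | hc) hac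
          · exact absurd hac (lt_irrefl _)
          · exact le_rfl
          · exact (hy c hc).le
        · refine ⟨.inr ha, .inr hb, hab, ?_⟩
          rintro c (rfl | hc') hac
          · exact absurd (hx a ha) hac.asymm
          · exact hc c hc' hac
      · rintro ⟨rfl | ha, hb, hab, hc⟩
        · have := hc y (.inr (.inl rfl)) hxy
          rcases hb with rfl | rfl | hb
          · exact absurd hab (lt_irrefl _)
          · exact .inl ⟨rfl, rfl⟩
          · exact absurd (hy b hb) this.not_gt
        · refine .inr ⟨ha, hb.resolve_left ?_, hab, fun c hc' => hc c (.inr hc')⟩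
          rintro rfl
          exact hab.asymm (hx a ha)

theorem maxGap_le_iff (f : ℤ[X]) (m : ℕ) :
    maxGap f ≤ m ↔ ∀ a ∈ f.support, ∀ b ∈ f.support, a < b →
      (∀ c ∈ f.support, a < c → b ≤ c) → b - a ≤ m := by
  have hs : (f.support.sort (· ≤ ·)).Pairwise (· < ·) := (Finset.sortedLT_sort _).pairwise
  unfold maxGap
  rw [List.foldr_max_zero_le_iff]
  simp only [List.mem_map, Prod.exists, List.mem_zip_tail_iff hs, Finset.mem_sort]
  grind

/-- Membership in the numerical semigroup generated by `p` and `q`. -/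
def IsNatComb (p q n : ℕ) : Prop := ∃ a b : ℕ, n = a * p + b * q

theorem IsNatComb.add_mul_left {p q n : ℕ} (h : IsNatComb p q n) (k : ℕ) :
    IsNatComb p q (n + k * p) := by
  obtain ⟨a, b, rfl⟩ := h
  exact ⟨a + k, b, by ring⟩

theorem isNatComb_mul_left (p q k : ℕ) : IsNatComb p q (k * p) := ⟨k, 0, by simp⟩

theorem not_isNatComb_of_lt {p q n : ℕ} (h0 : 0 < n) (hp : n < p) (hq : n < q) :
    ¬ IsNatComb p q n := by
  rintro ⟨a, b, rfl⟩
  rcases a with _ | a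
  · rcases b with _ | b
    · simp at h0
    · nlinarith
  · nlinarith

theorem isNatComb_and_not_sub_iff {p q : ℕ} (hpq : p.Coprime q) (hq : 0 < q) (n : ℕ) :
    IsNatComb p q n ∧ ¬ (p ≤ n ∧ IsNatComb p q (n - p)) ↔ ∃ b < p, n = b * q := by
  constructor
  · rintro ⟨⟨a, b, rfl⟩, hn⟩
    have ha : a = 0 := by
      by_contra ha
      obtain ⟨a, rfl⟩ := Nat.exists_eq_succ_of_ne_zero ha
      have e : (a + 1) * p + b * q = p + (a * p + b * q) := by ring
      rw [Nat.succ_eq_add_one, e] at hn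
      exact hn ⟨by omega, a, b, by omega⟩
    subst ha
    refine ⟨b, ?_, by simp⟩
    by_contra! hb
    obtain ⟨c, rfl⟩ := Nat.exists_eq_add_of_le hb
    obtain ⟨r, rfl⟩ := Nat.exists_eq_succ_of_ne_zero hq.ne'
    have e : 0 * p + (p + c) * (r + 1) = p + (r * p + c * (r + 1)) := by ring
    rw [Nat.succ_eq_add_one, e] at hn
    exact hn ⟨by omega, r, c, by omega⟩
  · rintro ⟨b, hb, rfl⟩
    refine ⟨⟨0, b, by simp⟩, ?_⟩
    rintro ⟨hle, a, c, h⟩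
    have h' : b * q = (a + 1) * p + c * q := by
      have := Nat.sub_add_cancel hle
      rw [h] at this
      rw [← this]
      ring
    have hcb : c < b := by
      by_contra! hbc
      have := Nat.mul_le_mul_right q hbc
      have : 0 < (a + 1) * p := Nat.mul_pos (by omega) (by omega)
      omega
    obtain ⟨d, rfl⟩ := Nat.exists_eq_add_of_lt hcb
    have hd : p ∣ (d + 1) * q := ⟨a + 1, by linarith⟩
    have := Nat.le_of_dvd (by omega) (hpq.dvd_of_dvd_mul_right hd)
    omega

/-- The Hilbert series of the numerical semigroup generated by `p` and `q`. -/
noncomputable def hilbertSeries (p q : ℕ) : PowerSeries ℤ :=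
  open Classical in PowerSeries.mk fun n => if IsNatComb p q n then 1 else 0

theorem one_sub_X_pow_mul_hilbertSeries {p q : ℕ} (hpq : p.Coprime q) (hq : 0 < q) :
    (1 - PowerSeries.X ^ p) * hilbertSeries p q =
      ∑ b ∈ Finset.range p, (PowerSeries.X ^ q) ^ b := by
  classical
  ext n
  have key := isNatComb_and_not_sub_iff hpq hq n
  have hadd : p ≤ n → IsNatComb p q (n - p) → IsNatComb p q n := fun h hS => by
    simpa [Nat.sub_add_cancel h] using hS.add_mul_left 1
  have hsum : PowerSeries.coeff n (∑ b ∈ Finset.range p, (PowerSeries.X ^ q) ^ b : PowerSeries ℤ)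
      = if ∃ b < p, n = b * q then 1 else 0 := by
    simp only [map_sum, ← pow_mul, PowerSeries.coeff_X_pow]
    split_ifs with h
    · obtain ⟨b, hb, rfl⟩ := h
      rw [Finset.sum_eq_single b]
      · simp [mul_comm]
      · intro c _ hc
        rw [if_neg]
        intro e
        rw [mul_comm] at e
        exact hc (Nat.eq_of_mul_eq_mul_left hq e).symm
      · simp [hb]
    · refine Finset.sum_eq_zero fun b hb => if_neg fun e => h ⟨b, Finset.mem_range.1 hb, ?_⟩
      rw [e, mul_comm]
  rw [hsum, sub_mul, one_mul, map_sub, PowerSeries.coeff_X_pow_mul']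
  simp only [hilbertSeries, PowerSeries.coeff_mk]
  grind

theorem coe_cyclotomic_eq_one_sub_X_mul_hilbertSeries {p q : ℕ} (hp : p.Prime) (hq : q.Prime)
    (hne : p ≠ q) :
    (cyclotomic (p * q) ℤ : PowerSeries ℤ) = (1 - PowerSeries.X) * hilbertSeries p q := by
  have := Fact.mk hp
  have hexp := cyclotomic_expand_eq_cyclotomic_mul hq
    (fun h => hne ((Nat.prime_dvd_prime_iff_eq hq hp).1 h).symm) ℤ
  have hX := cyclotomic_prime_mul_X_sub_one ℤ p
  have hpoly : cyclotomic (p * q) ℤ * (X ^ p - 1) =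
      (∑ b ∈ Finset.range p, (X ^ q) ^ b) * (X - 1) := by
    rw [← hX, ← mul_assoc, ← hexp, cyclotomic_prime]
    simp
  have hser := congrArg (fun f : ℤ[X] => (f : PowerSeries ℤ)) hpoly
  have hcoe : ((∑ b ∈ Finset.range p, (X ^ q) ^ b : ℤ[X]) : PowerSeries ℤ) =
      ∑ b ∈ Finset.range p, (PowerSeries.X ^ q) ^ b := by
    rw [← Polynomial.coeToPowerSeries.ringHom_apply, map_sum]
    simp
  simp only [Polynomial.coe_mul, Polynomial.coe_sub, Polynomial.coe_pow, Polynomial.coe_X,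
    Polynomial.coe_one, hcoe] at hser
  rw [← one_sub_X_pow_mul_hilbertSeries ((Nat.coprime_primes hp hq).2 hne) hq.pos] at hser
  have h0 : (1 - PowerSeries.X ^ p : PowerSeries ℤ) ≠ 0 := by
    intro h
    simpa [hp.ne_zero] using congrArg PowerSeries.constantCoeff h
  apply mul_left_cancel₀ h0
  linear_combination -hser

theorem succ_mem_support_cyclotomic_iff {p q : ℕ} (hp : p.Prime) (hq : q.Prime) (hne : p ≠ q)
    (n : ℕ) :
    n + 1 ∈ (cyclotomic (p * q) ℤ).support ↔ ¬ (IsNatComb p q (n + 1) ↔ IsNatComb p q n) := by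
  classical
  rw [mem_support_iff, ← Polynomial.coeff_coe,
    coe_cyclotomic_eq_one_sub_X_mul_hilbertSeries hp hq hne, sub_mul, one_mul, map_sub,
    PowerSeries.coeff_succ_X_mul]
  simp only [hilbertSeries, PowerSeries.coeff_mk]
  grind

theorem maxGap_cyclotomic_two_primes (p1 p2 : ℕ) (hp1 : p1.Prime) (hp2 : p2.Prime)
    (hodd1 : Odd p1) (hodd2 : Odd p2) (hlt : p1 < p2) :
    maxGap (cyclotomic (p1 * p2) ℤ) = p1 - 1 := by
  have hsupp := succ_mem_support_cyclotomic_iff hp1 hp2 hlt.ne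
  have h2 := hp1.two_le
  apply le_antisymm
  · rw [maxGap_le_iff]
    intro a _ b hb hab hmin
    by_contra! hlen
    have hconst : ∀ k < p1, (IsNatComb p1 p2 (a + k) ↔ IsNatComb p1 p2 a) := by
      intro k
      induction k with
      | zero => simp
      | succ k ih =>
        intro hk
        rw [← ih (by omega)]
        by_contra hne
        have := hmin _ ((hsupp (a + k)).2 hne) (by omega)
        omega
    by_cases ha : IsNatComb p1 p2 a
    · have hall : ∀ n, a ≤ n → IsNatComb p1 p2 n := by
        intro n hn
        have hmod := (hconst _ (Nat.mod_lt (n - a) hp1.pos)).2 ha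
        convert hmod.add_mul_left ((n - a) / p1) using 1
        have := Nat.mod_add_div' (n - a) p1
        omega
      obtain ⟨n, rfl⟩ := Nat.exists_eq_succ_of_ne_zero (show b ≠ 0 by omega)
      exact (hsupp n).1 hb (iff_of_true (hall _ (by omega)) (hall _ (by omega)))
    · have hk := Nat.mod_add_div' (a + (p1 - 1)) p1
      have hlt' := Nat.mod_lt (a + (p1 - 1)) hp1.pos
      have hmul := isNatComb_mul_left p1 p2 ((a + (p1 - 1)) / p1)
      refine ha ((hconst ((a + (p1 - 1)) / p1 * p1 - a) (by omega)).1 ?_)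
      rwa [Nat.add_sub_cancel' (by omega)]
  · have hgap := (maxGap_le_iff (cyclotomic (p1 * p2) ℤ) _).1 le_rfl
    have hno : ∀ n, 0 < n → n < p1 → ¬ IsNatComb p1 p2 n := fun n h h' =>
      not_isNatComb_of_lt h h' (h'.trans hlt)
    have hone : 1 ∈ (cyclotomic (p1 * p2) ℤ).support := by
      have h0 : IsNatComb p1 p2 0 := by simpa using isNatComb_mul_left p1 p2 0
      exact (hsupp 0).2 fun h => hno 1 one_pos (by omega) (h.2 h0)
    have hp : p1 ∈ (cyclotomic (p1 * p2) ℤ).support := by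
      have hself : IsNatComb p1 p2 p1 := by simpa using isNatComb_mul_left p1 p2 1
      have := hsupp (p1 - 1)
      rw [Nat.sub_add_cancel hp1.one_le] at this
      exact this.2 fun h => hno (p1 - 1) (by omega) (by omega) (h.1 hself)
    refine hgap 1 hone p1 hp (by omega) fun c hc h1c => ?_
    by_contra! hcp
    obtain ⟨n, rfl⟩ := Nat.exists_eq_succ_of_ne_zero (show c ≠ 0 by omega)
    exact (hsupp n).1 hc (iff_of_false (hno _ (by omega) hcp) (hno _ (by omega) (by omega)))
end

section
/- Let n = p1·p2·p3 where p1 < p2 < p3 are odd primes satisfying p2 ≥ 4(p1 - 1) or p3 ≥ p1². Then g(Ψ_n) = 2n/p1 - deg(Ψ_n), i.e., the maximum gap of the inverse cyclotomic polynomial Ψ_n equals 2·p2·p3 minus the degree of Ψ_n. -/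
open Polynomial

/-- The `n`-th inverse cyclotomic polynomial `Ψₙ(x) = (xⁿ - 1)/Φₙ(x)`. -/
noncomputable def invCyclotomic (n : ℕ) : Polynomial ℤ :=
  (X ^ n - 1) /ₘ cyclotomic n ℤ

theorem List.foldr_max_zip_tail_le {G : ℕ} (l : List ℕ) (hl : l.Pairwise (· < ·))
    (h : ∀ a ∈ l, ∀ b ∈ l, a < b → ∃ c ∈ l, a < c ∧ c ≤ a + G) :
    ((l.zip l.tail).map (fun p => p.2 - p.1)).foldr max 0 ≤ G := by
  induction l with
  | nil => simp
  | cons x t ih =>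
    cases t with
    | nil => simp
    | cons y t =>
      have hx := (List.pairwise_cons.1 hl).1
      have ht := (List.pairwise_cons.1 hl).2
      have hy := (List.pairwise_cons.1 ht).1
      simp only [List.tail_cons, List.zip_cons_cons, List.map_cons, List.foldr_cons]
      refine max_le ?_ (ih ht ?_)
      · obtain ⟨c, hc, hxc, hcG⟩ := h x (by simp) y (by simp) (hx y (by simp))
        have : y ≤ c := by
          simp only [List.mem_cons] at hc
          rcases hc with rfl | rfl | hc
          · omega
          · exact le_rfl
          · exact (hy c hc).le
        omega
      · intro a ha b hb hab
        obtain ⟨c, hc, hac, hcG⟩ :=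
          h a (List.mem_cons_of_mem _ ha) b (List.mem_cons_of_mem _ hb) hab
        refine ⟨c, ?_, hac, hcG⟩
        rcases List.mem_cons.1 hc with rfl | hc
        · have := hx a ha
          omega
        · exact hc

theorem List.sub_le_foldr_max_zip_tail (l : List ℕ) (hl : l.Pairwise (· < ·)) {a b : ℕ}
    (ha : a ∈ l) (hb : b ∈ l) (hab : a < b) (h : ∀ c ∈ l, a < c → b ≤ c) :
    b - a ≤ ((l.zip l.tail).map (fun p => p.2 - p.1)).foldr max 0 := by
  induction l with
  | nil => simp at ha
  | cons x t ih =>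
    have hx := (List.pairwise_cons.1 hl).1
    have hbt : b ∈ t := by
      rcases List.mem_cons.1 hb with rfl | hb
      · rcases List.mem_cons.1 ha with rfl | ha
        · omega
        · have := hx a ha
          omega
      · exact hb
    cases t with
    | nil => simp at hbt
    | cons y t =>
      have ht := (List.pairwise_cons.1 hl).2
      simp only [List.tail_cons, List.zip_cons_cons, List.map_cons, List.foldr_cons]
      rcases List.mem_cons.1 ha with rfl | ha
      · have := h y (by simp) (hx y (by simp))
        exact le_max_of_le_left (by omega)
      · exact le_max_of_le_right
          (ih ht ha hbt fun c hc => h c (List.mem_cons_of_mem _ hc))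

theorem maxGap_eq_of_support {f : Polynomial ℤ} {a b : ℕ}
    (ha : a ∈ f.support) (hb : b ∈ f.support) (hab : a < b)
    (hgap : ∀ c ∈ f.support, a < c → b ≤ c)
    (h : ∀ x ∈ f.support, ∀ y ∈ f.support, x < y →
      ∃ z ∈ f.support, x < z ∧ z ≤ x + (b - a)) :
    maxGap f = b - a := by
  have hl : (f.support.sort (· ≤ ·)).Pairwise (· < ·) := f.support.sortedLT_sort.pairwise
  refine le_antisymm (List.foldr_max_zip_tail_le _ hl ?_)
    (List.sub_le_foldr_max_zip_tail _ hl ?_ ?_ hab ?_) <;>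
    simpa only [Finset.mem_sort]

theorem Polynomial.coeff_mul_geom_sum {R : Type*} [Semiring R] (f : R[X]) {M N : ℕ}
    (hN : f.natDegree ≤ N) (hM : N < M) :
    (f * ∑ j ∈ Finset.range M, X ^ j).coeff N = f.eval 1 := by
  rw [coeff_mul, Finset.Nat.sum_antidiagonal_eq_sum_range_succ_mk,
    eval_eq_sum_range' (Nat.lt_succ_of_le hN)]
  refine Finset.sum_congr rfl fun i hi => ?_
  have hlt : N - i < M := by omega
  simp [coeff_X_pow, hlt]

theorem Polynomial.exists_coeff_ne_zero_of_coeff_mul_geom_sum_ne_zero {R : Type*} [Semiring R]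
    {f : R[X]} {M N : ℕ} (h : (f * ∑ j ∈ Finset.range M, X ^ j).coeff N ≠ 0) :
    ∃ i, f.coeff i ≠ 0 ∧ i ≤ N ∧ N < i + M := by
  rw [coeff_mul] at h
  obtain ⟨⟨i, j⟩, hij, hne⟩ := Finset.exists_ne_zero_of_sum_ne_zero h
  have hsum : i + j = N := by simpa using hij
  refine ⟨i, left_ne_zero_of_mul hne, by omega, ?_⟩
  have hj := right_ne_zero_of_mul hne
  have hjM : j < M := by
    by_contra hjM
    exact hj (by simp [coeff_X_pow, hjM])
  omega

/-- The support of `(X ^ L - 1) * f` is made of two translates of the support of `f`. -/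
theorem Polynomial.mem_support_X_pow_sub_one_mul {f : ℤ[X]} {L : ℕ} (hL : f.natDegree < L)
    (i : ℕ) : i ∈ ((X ^ L - 1) * f).support ↔
      i ∈ f.support ∨ ∃ j ∈ f.support, i = j + L := by
  rw [mem_support_iff, sub_mul, one_mul, coeff_sub, coeff_X_pow_mul']
  split_ifs with h
  · have hi : f.coeff i = 0 := coeff_eq_zero_of_natDegree_lt (by omega)
    simp only [hi, sub_zero, mem_support_iff, ne_eq, not_true_eq_false, false_or]
    refine ⟨fun hne => ⟨i - L, hne, by omega⟩, ?_⟩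
    rintro ⟨j, hj, rfl⟩
    simpa using hj
  · simp only [zero_sub, neg_ne_zero, mem_support_iff]
    refine ⟨Or.inl, ?_⟩
    rintro (h' | ⟨j, -, rfl⟩)
    · exact h'
    · omega

theorem maxGap_X_pow_sub_one_mul {f : ℤ[X]} {L : ℕ} (hL : f.natDegree < L)
    (h0 : f.coeff 0 ≠ 0)
    (h : ∀ x ∈ f.support, x < f.natDegree →
      ∃ z ∈ f.support, x < z ∧ z ≤ x + (L - f.natDegree)) :
    maxGap ((X ^ L - 1) * f) = L - f.natDegree := by
  have hf : f ≠ 0 := by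
    rintro rfl
    simp at h0
  have hD : f.natDegree ∈ f.support := natDegree_mem_support_of_nonzero hf
  have h0' : 0 ∈ f.support := mem_support_iff.2 h0
  apply maxGap_eq_of_support _ _ hL <;> simp only [mem_support_X_pow_sub_one_mul hL]
  · rintro c (hc | ⟨j, -, rfl⟩) hlt
    · have := le_natDegree_of_mem_supp c hc
      omega
    · omega
  · rintro x (hx | ⟨j, hj, rfl⟩) y hy hxy
    · rcases (le_natDegree_of_mem_supp x hx).lt_or_eq with hlt | heq
      · obtain ⟨z, hz, hz'⟩ := h x hx hlt
        exact ⟨z, Or.inl hz, hz'⟩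
      · exact ⟨L, Or.inr ⟨0, h0', by simp⟩, by omega, by omega⟩
    · have hlt : j < f.natDegree := by
        rcases hy with hy | ⟨k, hk, rfl⟩
        · have := le_natDegree_of_mem_supp y hy
          omega
        · have := le_natDegree_of_mem_supp k hk
          omega
      obtain ⟨z, hz, hz'⟩ := h j hj hlt
      exact ⟨z + L, Or.inr ⟨z, hz, rfl⟩, by omega, by omega⟩
  · exact Or.inl hD
  · exact Or.inr ⟨0, h0', by simp⟩

theorem X_pow_sub_one_mul_geom_sum_mul_cyclotomic {p q : ℕ} (hp : p.Prime) (hq : q.Prime)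
    (hpq : p ≠ q) :
    (X ^ q - 1) * (∑ j ∈ Finset.range p, X ^ j) * cyclotomic (p * q) ℤ = X ^ (p * q) - 1 := by
  have hdvd : ¬ p ∣ q := fun h => hpq ((Nat.prime_dvd_prime_iff_eq hp hq).1 h)
  have h1 := cyclotomic_expand_eq_cyclotomic_mul hp hdvd ℤ
  have : Fact q.Prime := ⟨hq⟩
  have h2 : cyclotomic q ℤ * (X - 1) = X ^ q - 1 := cyclotomic_prime_mul_X_sub_one ℤ q
  have h3 : (∑ j ∈ Finset.range p, (X : ℤ[X]) ^ j) * (X - 1) = X ^ p - 1 := geom_sum_mul X p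
  have h4 := congrArg (expand ℤ p) h2
  simp only [map_mul, map_sub, map_pow, expand_X, map_one, ← pow_mul] at h4
  rw [← h4, h1, ← h3, ← h2, mul_comm q p]
  ring

theorem invCyclotomic_eq {p q r : ℕ} (hp : p.Prime) (hq : q.Prime) (hr : r.Prime)
    (hpq : p ≠ q) (hpr : p ≠ r) (hqr : q ≠ r) :
    invCyclotomic (p * q * r) = (X ^ (q * r) - 1) *
      (cyclotomic (p * q) ℤ * ∑ j ∈ Finset.range p, (X ^ r) ^ j) := by
  have hdvd : ¬ r ∣ p * q := by
    rw [hr.dvd_mul, Nat.prime_dvd_prime_iff_eq hr hp, Nat.prime_dvd_prime_iff_eq hr hq]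
    tauto
  have h1 := cyclotomic_expand_eq_cyclotomic_mul hr hdvd ℤ
  have h2 := congrArg (expand ℤ r) (X_pow_sub_one_mul_geom_sum_mul_cyclotomic hp hq hpq)
  simp only [map_mul, map_sub, map_pow, expand_X, map_one, map_sum, ← pow_mul] at h2
  rw [h1, mul_comm r q, mul_comm r (p * q)] at h2
  rw [invCyclotomic, ← h2]
  simp only [← pow_mul]
  rw [show ∀ a b c d : ℤ[X], a * b * (c * d) = c * (a * (d * b)) by intros; ring]
  exact mul_divByMonic_cancel_left _ (cyclotomic.monic _ _)

theorem two_mul_sub_one_mul_sub_one_le {p q r : ℤ} (hp : 1 ≤ p) (hpq : p + 2 ≤ q) (hqr : q < r)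
    (h : 4 * (p - 1) ≤ q ∨ p ^ 2 ≤ r) : 2 * ((p - 1) * (q - 1)) ≤ r * (q - p) := by
  rcases h with h | h
  · have h1 := mul_le_mul_of_nonneg_right h (show 0 ≤ q - 1 by omega)
    have h2 := mul_le_mul_of_nonneg_right hqr.le (show 0 ≤ q - p by omega)
    have h3 := mul_le_mul_of_nonneg_left h (show 0 ≤ q by omega)
    nlinarith
  · have h1 := mul_le_mul_of_nonneg_right h (show 0 ≤ q - p by omega)
    nlinarith [mul_nonneg (show 0 ≤ q - p - 2 by omega) (sq_nonneg (p - 1))]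

theorem maxGap_invCyclotomic_three_primes (p1 p2 p3 n : ℕ)
    (hp1 : p1.Prime) (hp2 : p2.Prime) (hp3 : p3.Prime)
    (hodd1 : Odd p1) (hodd2 : Odd p2) (hodd3 : Odd p3)
    (h12 : p1 < p2) (h23 : p2 < p3) (hn : n = p1 * p2 * p3)
    (hcond : 4 * (p1 - 1) ≤ p2 ∨ p1 ^ 2 ≤ p3) :
    (maxGap (invCyclotomic n) : ℤ) =
      2 * p2 * p3 - (invCyclotomic n).natDegree := by
  subst hn
  rw [invCyclotomic_eq hp1 hp2 hp3 h12.ne (h12.trans h23).ne h23.ne]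
  set Φ := cyclotomic (p1 * p2) ℤ with hΦ
  set S : ℤ[X] := ∑ j ∈ Finset.range p1, (X ^ p3) ^ j with hS
  have hcop : p1.Coprime p2 := (Nat.coprime_primes hp1 hp2).2 h12.ne
  have hdegΦ : Φ.natDegree = (p1 - 1) * (p2 - 1) := by
    rw [hΦ, natDegree_cyclotomic, Nat.totient_mul hcop, Nat.totient_prime hp1,
      Nat.totient_prime hp2]
  have hSexp : S = expand ℤ p3 (∑ j ∈ Finset.range p1, X ^ j) := by simp [hS]
  have hgeom : (∑ j ∈ Finset.range p1, (X : ℤ[X]) ^ j) = cyclotomic p1 ℤ := by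
    have : Fact p1.Prime := ⟨hp1⟩
    rw [cyclotomic_prime]
  have hSmonic : S.Monic := by
    rw [hSexp, hgeom]
    exact (cyclotomic.monic _ _).expand hp3.pos
  have hdegS : S.natDegree = (p1 - 1) * p3 := by
    rw [hSexp, hgeom, natDegree_expand, natDegree_cyclotomic, Nat.totient_prime hp1]
  have hmonic : (Φ * S).Monic := (cyclotomic.monic _ _).mul hSmonic
  have hdeg : (Φ * S).natDegree = (p1 - 1) * (p2 - 1) + (p1 - 1) * p3 := by
    rw [(cyclotomic.monic _ _).natDegree_mul hSmonic, hdegΦ, hdegS]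
  have hΦ0 : Φ.coeff 0 = 1 := cyclotomic_coeff_zero ℤ (by nlinarith [hp1.two_le, hp2.two_le])
  have hS0 : S.coeff 0 = 1 := by
    rw [hSexp, hgeom, coeff_zero_eq_eval_zero, expand_eval, zero_pow hp3.ne_zero,
      ← coeff_zero_eq_eval_zero, cyclotomic_coeff_zero ℤ hp1.one_lt]
  have h0 : (Φ * S).coeff 0 ≠ 0 := by
    rw [mul_coeff_zero, hΦ0, hS0]
    simp
  have hΦ1 : Φ.eval 1 = 1 := by
    apply eval_one_cyclotomic_not_prime_pow
    intro p hp k hk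
    have e1 : p1 ∣ p ^ k := hk ▸ Dvd.intro _ rfl
    have e2 : p2 ∣ p ^ k := hk ▸ Dvd.intro_left _ rfl
    have e1' := (Nat.prime_dvd_prime_iff_eq hp1 hp).1 (hp1.dvd_of_dvd_pow e1)
    have e2' := (Nat.prime_dvd_prime_iff_eq hp2 hp).1 (hp2.dvd_of_dvd_pow e2)
    omega
  have hmul : Φ * S * ∑ j ∈ Finset.range p3, X ^ j = Φ * ∑ j ∈ Finset.range (p1 * p3), X ^ j := by
    have h1 : (X - 1 : ℤ[X]) ≠ 0 := X_sub_C_ne_zero 1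
    apply mul_right_cancel₀ h1
    have e1 : S * (X ^ p3 - 1) = X ^ (p1 * p3) - 1 := by
      rw [hS, geom_sum_mul, ← pow_mul, mul_comm p3]
    rw [mul_assoc, mul_assoc, geom_sum_mul, e1, mul_assoc, geom_sum_mul]
  have hwindow : ∀ N, (p1 - 1) * (p2 - 1) ≤ N → N < p1 * p3 →
      ∃ i ∈ (Φ * S).support, i ≤ N ∧ N < i + p3 := by
    intro N hN hN'
    obtain ⟨i, hi, hi'⟩ := exists_coeff_ne_zero_of_coeff_mul_geom_sum_ne_zero
      (f := Φ * S) (M := p3) (N := N)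
      (by rw [hmul, coeff_mul_geom_sum Φ (hdegΦ ▸ hN) hN', hΦ1]; exact one_ne_zero)
    exact ⟨i, mem_support_iff.2 hi, hi'⟩
  have hineq : 2 * ((p1 - 1) * (p2 - 1)) + p3 + (p1 - 1) * p3 ≤ p2 * p3 := by
    have h12' : p1 + 2 ≤ p2 := by
      obtain ⟨a, rfl⟩ := hodd1
      obtain ⟨b, rfl⟩ := hodd2
      omega
    have hp1' := hp1.one_le
    have hp2' := hp2.one_le
    have := two_mul_sub_one_mul_sub_one_le (p := p1) (q := p2) (r := p3)
      (by omega) (by omega) (by omega) (by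
        rcases hcond with h | h
        · left; omega
        · right; exact_mod_cast h)
    zify [hp1', hp2']
    linarith
  have hle : (p1 - 1) * (p2 - 1) ≤ (p1 - 1) * p3 := Nat.mul_le_mul_left _ (by omega)
  have hp13 : p1 * p3 = (p1 - 1) * p3 + p3 := by
    rw [← Nat.succ_mul, Nat.succ_eq_add_one, Nat.sub_add_cancel hp1.one_le]
  have hp3pos := hp3.pos
  have hL : (Φ * S).natDegree < p2 * p3 := by omega
  have hdeg' : ((X ^ (p2 * p3) - 1) * (Φ * S)).natDegree = p2 * p3 + (Φ * S).natDegree := by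
    have hm : (X ^ (p2 * p3) - 1 : ℤ[X]).Monic := monic_X_pow_sub_C 1 (by omega)
    have hd : (X ^ (p2 * p3) - 1 : ℤ[X]).natDegree = p2 * p3 := natDegree_X_pow_sub_C (r := 1)
    rw [hm.natDegree_mul hmonic, hd]
  rw [hdeg', maxGap_X_pow_sub_one_mul hL h0]
  · push_cast [hL.le]
    ring
  · intro x hx hxD
    rw [hdeg] at hxD ⊢
    by_cases hx1 : x < (p1 - 1) * (p2 - 1)
    · obtain ⟨i, hi, hi'⟩ := hwindow ((p1 - 1) * (p2 - 1) + p3 - 1) (by omega) (by omega)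
      exact ⟨i, hi, by omega, by omega⟩
    · by_cases hx2 : x + p3 < p1 * p3
      · obtain ⟨i, hi, hi'⟩ := hwindow (x + p3) (by omega) hx2
        exact ⟨i, hi, by omega, by omega⟩
      · refine ⟨(Φ * S).natDegree, natDegree_mem_support_of_nonzero hmonic.ne_zero, ?_, ?_⟩ <;>
          omega
end

section
/- Let n = p1·p2·p3 where p1 < p2 < p3 are odd primes. Then max{ p1 - 1, 2n/p1 - deg(Ψ_n) } ≤ g(Ψ_n), where the left-hand side is computed in the integers (2n/p1 = 2·p2·p3). -/
open Polynomial

theorem sub_le_foldr_max_gaps {l : List ℕ} (hl : l.Pairwise (· ≤ ·)) {a b c d : ℕ}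
    (hc : c ∈ l) (hca : c ≤ a) (hd : d ∈ l) (hbd : b ≤ d) (h : ∀ k ∈ l, k ≤ a ∨ b ≤ k) :
    b - a ≤ ((l.zip l.tail).map (fun p => p.2 - p.1)).foldr max 0 := by
  induction l generalizing c with
  | nil => simp at hc
  | cons x t ih =>
    have hxa : x ≤ a := by
      rcases List.mem_cons.1 hc with rfl | hct
      · exact hca
      · exact (List.rel_of_pairwise_cons hl hct).trans hca
    cases t with
    | nil =>
      have hdx : d = x := by simpa using hd
      omega
    | cons y t =>
      simp only [List.tail_cons, List.zip_cons_cons, List.map_cons, List.foldr_cons, le_max_iff]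
      rcases List.mem_cons.1 hd with hdx | hdt
      · omega
      rcases h y (by simp) with hya | hby
      · exact Or.inr (ih hl.of_cons List.mem_cons_self hya hdt
          fun k hk => h k (List.mem_cons_of_mem x hk))
      · omega

theorem sub_le_maxGap {f : ℤ[X]} {a b c d : ℕ} (hc : f.coeff c ≠ 0) (hca : c ≤ a)
    (hd : f.coeff d ≠ 0) (hbd : b ≤ d) (h : ∀ k, a < k → k < b → f.coeff k = 0) :
    b - a ≤ maxGap f := by
  refine sub_le_foldr_max_gaps (f.support.pairwise_sort (· ≤ ·)) (c := c) (d := d)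
    (by simpa using hc) hca (by simpa using hd) hbd fun k hk => ?_
  have hk' : f.coeff k ≠ 0 := by simpa using hk
  by_contra! hlt
  exact hk' (h k hlt.1 hlt.2)

theorem sub_natDegree_le_maxGap_mul_X_pow_sub_one {f : ℤ[X]} (hf : f.Monic) (m : ℕ) :
    m - f.natDegree ≤ maxGap (f * (X ^ m - 1)) := by
  rcases le_or_gt m f.natDegree with hm | hm
  · simp [Nat.sub_eq_zero_of_le hm]
  have hcoeff : ∀ k < m, (f * (X ^ m - 1)).coeff k = -f.coeff k := fun k hk => by
    simp [mul_sub, coeff_mul_X_pow', hk.not_ge]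
  refine sub_le_maxGap (c := f.natDegree) (d := f.natDegree + m) ?_ le_rfl ?_
    (Nat.le_add_left _ _) fun k hk hkm => ?_
  · simp [hcoeff _ hm, hf.coeff_natDegree]
  · have : f.coeff (f.natDegree + m) = 0 := coeff_eq_zero_of_natDegree_lt (by omega)
    simp [mul_sub, coeff_mul_X_pow, this, hf.coeff_natDegree]
  · rw [hcoeff k hkm, coeff_eq_zero_of_natDegree_lt hk, neg_zero]

theorem cyclotomic_mul_invCyclotomic (n : ℕ) :
    cyclotomic n ℤ * invCyclotomic n = X ^ n - 1 := by
  have hdvd : cyclotomic n ℤ ∣ X ^ n - 1 := cyclotomic.dvd_X_pow_sub_one n ℤ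
  have hmod := (modByMonic_eq_zero_iff_dvd (cyclotomic.monic n ℤ)).2 hdvd
  have := modByMonic_add_div (X ^ n - 1 : ℤ[X]) (cyclotomic n ℤ)
  rwa [hmod, zero_add] at this

theorem cyclotomic_prime_mul_prime_mul {p q : ℕ} (hp : p.Prime) (hq : q.Prime) (hpq : p ≠ q) :
    cyclotomic (p * q) ℤ * cyclotomic p ℤ * (X ^ q - 1) = X ^ (p * q) - 1 := by
  have : Fact p.Prime := ⟨hp⟩
  rw [← cyclotomic_expand_eq_cyclotomic_mul hq
    (fun h => hpq ((Nat.prime_dvd_prime_iff_eq hq hp).1 h).symm)]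
  have h := congrArg (expand ℤ q) (cyclotomic_prime_mul_X_sub_one ℤ p)
  simpa [← pow_mul, mul_comm q p] using h

theorem invCyclotomic_mul_three_primes {p q r : ℕ} (hp : p.Prime) (hq : q.Prime) (hr : r.Prime)
    (hpq : p ≠ q) (hpr : p ≠ r) (hqr : q ≠ r) :
    invCyclotomic (p * q * r) =
      cyclotomic (p * q) ℤ * expand ℤ r (cyclotomic p ℤ) * (X ^ (q * r) - 1) := by
  have hndvd : ¬ r ∣ p * q := by
    rw [hr.dvd_mul, Nat.prime_dvd_prime_iff_eq hr hp, Nat.prime_dvd_prime_iff_eq hr hq]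
    tauto
  have hexp := cyclotomic_expand_eq_cyclotomic_mul hr hndvd ℤ
  have hinv := cyclotomic_mul_invCyclotomic (p * q * r)
  have h := congrArg (expand ℤ r) (cyclotomic_prime_mul_prime_mul hp hq hpq)
  simp only [map_mul, map_sub, map_pow, expand_X, map_one, ← pow_mul, mul_comm r] at h
  rw [← hinv, hexp] at h
  refine mul_left_cancel₀ (cyclotomic_ne_zero (p * q * r) ℤ) ?_
  linear_combination -h

theorem X_pow_dvd_invCyclotomic_sub {p q r : ℕ} (hp : p.Prime) (hq : q.Prime) (hr : r.Prime)
    (hpq : p < q) (hqr : q < r) :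
    (X : ℤ[X]) ^ p ∣ invCyclotomic (p * q * r) - (X - 1) := by
  have : Fact p.Prime := ⟨hp⟩
  rw [invCyclotomic_mul_three_primes hp hq hr hpq.ne (hpq.trans hqr).ne hqr.ne]
  have hX : ∀ m, p ≤ m → ∃ u : ℤ[X], X ^ m = X ^ p * u := fun m hm => pow_dvd_pow X hm
  obtain ⟨u, hu⟩ := hX q hpq.le
  obtain ⟨v, hv⟩ := hX (p * q) (Nat.le_mul_of_pos_right p hq.pos)
  obtain ⟨w, hw⟩ := hX (q * r) (hpq.le.trans (Nat.le_mul_of_pos_right q hr.pos))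
  obtain ⟨s, hs⟩ := hX r (hpq.trans hqr).le
  obtain ⟨t, ht⟩ := hX (r * p) (Nat.le_mul_of_pos_left p hr.pos)
  have hone := cyclotomic_prime_mul_X_sub_one ℤ p
  have hF := cyclotomic_prime_mul_prime_mul hp hq hpq.ne
  have hE := congrArg (expand ℤ r) hone
  simp only [map_mul, map_sub, map_pow, expand_X, map_one, ← pow_mul] at hE
  rw [hs, ht] at hE
  rw [hu, hv] at hF
  rw [hw]
  generalize expand ℤ r (cyclotomic p ℤ) = E at *
  generalize cyclotomic (p * q) ℤ = F at *
  have hF' : F = 1 - X + X ^ p * (F * (1 + u) - F * X ^ p * u + v * (X - 1)) := by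
    linear_combination (X - 1) * hF - F * (X ^ p * u - 1) * hone
  have hE' : E = 1 + X ^ p * (E * s - t) := by linear_combination -hE
  generalize F * (1 + u) - F * X ^ p * u + v * (X - 1) = f at hF'
  generalize E * s - t = e at hE'
  rw [hF', hE']
  exact ⟨(1 - X + X ^ p * f) * (1 + X ^ p * e) * w - (1 - X) * e - f - X ^ p * f * e, by ring⟩

theorem maxGap_invCyclotomic_lower_bound (p1 p2 p3 n : ℕ)
    (hp1 : p1.Prime) (hp2 : p2.Prime) (hp3 : p3.Prime)
    (hodd1 : Odd p1) (hodd2 : Odd p2) (hodd3 : Odd p3)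
    (h12 : p1 < p2) (h23 : p2 < p3) (hn : n = p1 * p2 * p3) :
    max ((p1 : ℤ) - 1) (2 * p2 * p3 - (invCyclotomic n).natDegree) ≤
      (maxGap (invCyclotomic n) : ℤ) := by
  subst hn
  have hfac := invCyclotomic_mul_three_primes hp1 hp2 hp3 h12.ne (h12.trans h23).ne h23.ne
  have hA : (cyclotomic (p1 * p2) ℤ * expand ℤ p3 (cyclotomic p1 ℤ)).Monic :=
    (cyclotomic.monic _ ℤ).mul ((cyclotomic.monic _ ℤ).expand hp3.pos)
  have hB : (X ^ (p2 * p3) - 1 : ℤ[X]).Monic :=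
    monic_X_pow_sub_C 1 (Nat.mul_pos hp2.pos hp3.pos).ne'
  have hmonic : (invCyclotomic (p1 * p2 * p3)).Monic := hfac ▸ hA.mul hB
  have hdeg : (invCyclotomic (p1 * p2 * p3)).natDegree =
      (cyclotomic (p1 * p2) ℤ * expand ℤ p3 (cyclotomic p1 ℤ)).natDegree + p2 * p3 := by
    rw [hfac, hA.natDegree_mul hB]
    congr 1
    exact natDegree_X_pow_sub_C
  refine max_le ?_ ?_
  · have hp3le : 3 ≤ p1 := by
      have := hp1.two_le
      obtain ⟨k, rfl⟩ := hodd1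
      omega
    obtain ⟨g, hg⟩ := X_pow_dvd_invCyclotomic_sub hp1 hp2 hp3 h12 h23
    have hcoeff : ∀ k < p1, (invCyclotomic (p1 * p2 * p3)).coeff k = (X - 1 : ℤ[X]).coeff k :=
      fun k hk => by
        rw [sub_eq_iff_eq_add.1 hg, coeff_add, coeff_X_pow_mul', if_neg hk.not_ge, zero_add]
    have hle : p1 ≤ (invCyclotomic (p1 * p2 * p3)).natDegree := by
      have := Nat.le_mul_of_pos_right p2 hp3.pos
      omega
    have hgap : p1 - 1 ≤ maxGap (invCyclotomic (p1 * p2 * p3)) := by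
      refine sub_le_maxGap (c := 1) ?_ le_rfl (by rw [hmonic.coeff_natDegree]; exact one_ne_zero)
        hle fun k hk hkp => ?_
      · rw [hcoeff 1 (by omega)]
        simp [coeff_one]
      · rw [hcoeff k hkp]
        simp [coeff_X, coeff_one, hk.ne, (Nat.zero_lt_of_lt hk).ne']
    omega
  · have hgap := sub_natDegree_le_maxGap_mul_X_pow_sub_one hA (p2 * p3)
    rw [← hfac] at hgap
    rw [hdeg, mul_assoc]
    push_cast
    have hgap' := Nat.sub_le_iff_le_add.1 hgap
    zify at hgap'
    linarith
end

section
/- Let n = p1·p2·p3 where p1 < p2 < p3 are odd primes. Then g(Ψ_n) < 2n·(1/p1 + 1/p2 + 1/p3) - deg(Ψ_n), i.e., g(Ψ_n) < 2(p2·p3 + p1·p3 + p1·p2) - deg(Ψ_n). -/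
open Polynomial

theorem maxGap_le_natDegree (f : Polynomial ℤ) : maxGap f ≤ f.natDegree := by
  have foldr_le : ∀ (l : List ℕ) (d : ℕ), (∀ a ∈ l, a ≤ d) → l.foldr max 0 ≤ d := by
    intro l d h
    induction l with
    | nil => simp
    | cons a l ih => simp_all
  refine foldr_le _ _ fun a ha => ?_
  obtain ⟨⟨x, y⟩, hxy, rfl⟩ := List.mem_map.1 ha
  have hy : y ∈ f.support :=
    (Finset.mem_sort (· ≤ ·)).1 (List.mem_of_mem_tail (List.of_mem_zip hxy).2)
  exact (Nat.sub_le y x).trans (le_natDegree_of_mem_supp y hy)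

theorem natDegree_invCyclotomic (n : ℕ) :
    (invCyclotomic n).natDegree = n - n.totient := by
  rw [invCyclotomic, natDegree_divByMonic _ (cyclotomic.monic n ℤ), natDegree_cyclotomic,
    ← C_1, natDegree_X_pow_sub_C]

theorem maxGap_invCyclotomic_upper_bound (p1 p2 p3 n : ℕ)
    (hp1 : p1.Prime) (hp2 : p2.Prime) (hp3 : p3.Prime)
    (hodd1 : Odd p1) (hodd2 : Odd p2) (hodd3 : Odd p3)
    (h12 : p1 < p2) (h23 : p2 < p3) (hn : n = p1 * p2 * p3) :
    (maxGap (invCyclotomic n) : ℤ) <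
      2 * ((p2 : ℤ) * p3 + p1 * p3 + p1 * p2) - (invCyclotomic n).natDegree := by
  have hcop12 : p1.Coprime p2 := (Nat.coprime_primes hp1 hp2).2 h12.ne
  have hcop : (p1 * p2).Coprime p3 := Nat.Coprime.mul_left
    ((Nat.coprime_primes hp1 hp3).2 (h12.trans h23).ne) ((Nat.coprime_primes hp2 hp3).2 h23.ne)
  have hφ : (n.totient : ℤ) = (p1 - 1) * (p2 - 1) * (p3 - 1) := by
    rw [hn, Nat.totient_mul hcop, Nat.totient_mul hcop12, Nat.totient_prime hp1,
      Nat.totient_prime hp2, Nat.totient_prime hp3]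
    push_cast [Nat.cast_sub hp1.one_le, Nat.cast_sub hp2.one_le, Nat.cast_sub hp3.one_le]
    ring
  have hdeg : ((invCyclotomic n).natDegree : ℤ) =
      p2 * p3 + p1 * p3 + p1 * p2 - (p1 + p2 + p3) + 1 := by
    rw [natDegree_invCyclotomic, Nat.cast_sub (Nat.totient_le n), hφ, hn]
    push_cast
    ring
  have hgap : (maxGap (invCyclotomic n) : ℤ) ≤ (invCyclotomic n).natDegree :=
    mod_cast maxGap_le_natDegree _
  linarith [(mod_cast hp1.two_le : (2 : ℤ) ≤ p1), (mod_cast hp2.two_le : (2 : ℤ) ≤ p2),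
    (mod_cast hp3.two_le : (2 : ℤ) ≤ p3)]
end

section
/- Let A and B be nonzero polynomials with integer coefficients such that no cancellation of terms occurs when adding them, i.e., the set of exponents occurring in A + B equals the union of the sets of exponents occurring in A and in B. Then g(A + B) ≤ max{ g(A), g(B), tdeg(B) - deg(A), tdeg(A) - deg(B) }, where the differences tdeg(B) - deg(A) and tdeg(A) - deg(B) are computed in the integers. -/
open Polynomial

theorem List.foldr_max_zip_tail_sub_le_iff (n : ℕ) (l : List ℕ) (hl : l.Pairwise (· < ·)) :
    ((l.zip l.tail).map (fun p => p.2 - p.1)).foldr max 0 ≤ n ↔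
      ∀ x ∈ l, ∀ y ∈ l, x < y → (∀ z ∈ l, z ≤ x ∨ y ≤ z) → y ≤ x + n := by
  induction l with
  | nil => simp
  | cons a l ih =>
    cases l with
    | nil => simp
    | cons b t =>
      have ih' := ih hl.of_cons
      have ha : ∀ z ∈ b :: t, a < z := (List.pairwise_cons.mp hl).1
      have hb : ∀ z ∈ b :: t, b ≤ z := fun z hz => by
        rcases List.mem_cons.mp hz with rfl | hz
        · exact le_rfl
        · exact ((List.pairwise_cons.mp hl.of_cons).1 z hz).le
      have hab : a < b := ha b List.mem_cons_self
      simp only [List.tail_cons, List.zip_cons_cons, List.map_cons, List.foldr_cons,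
        max_le_iff] at ih' ⊢
      rw [ih']
      constructor
      · rintro ⟨h0, h⟩ x hx y hy hxy hz
        rcases List.mem_cons.mp hx with rfl | hx'
        · have := hz b (by simp)
          omega
        · rcases List.mem_cons.mp hy with rfl | hy'
          · have := ha x hx'
            omega
          · exact h x hx' y hy' hxy fun z hz' => hz z (List.mem_cons_of_mem _ hz')
      · intro h
        refine ⟨?_, fun x hx y hy hxy hz => h x (List.mem_cons_of_mem _ hx) y
          (List.mem_cons_of_mem _ hy) hxy fun z hz' => ?_⟩
        · have := h a (by simp) b (by simp) hab fun z hz => by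
            rcases List.mem_cons.mp hz with rfl | hz
            · exact Or.inl le_rfl
            · exact Or.inr (hb z hz)
          omega
        · rcases List.mem_cons.mp hz' with rfl | hz'
          · exact Or.inl (ha x hx).le
          · exact hz z hz'

theorem maxGap_le_iff_s4 (f : Polynomial ℤ) (n : ℕ) :
    maxGap f ≤ n ↔ ∀ x ∈ f.support, ∀ y ∈ f.support, x < y →
      (∀ z ∈ f.support, z ≤ x ∨ y ≤ z) → y ≤ x + n := by
  unfold maxGap
  rw [List.foldr_max_zip_tail_sub_le_iff n _ (Finset.sortedLT_sort _).pairwise]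
  simp only [Finset.mem_sort]

/-- An interval free of exponents of `f`, with exponents of `f` on both sides, has length at
most `maxGap f`. -/
theorem le_add_maxGap {f : Polynomial ℤ} {x y a b : ℕ} (hxy : x < y)
    (hgap : ∀ z ∈ f.support, z ≤ x ∨ y ≤ z) (ha : a ∈ f.support) (hax : a ≤ x)
    (hb : b ∈ f.support) (hyb : y ≤ b) : y ≤ x + maxGap f := by
  obtain ⟨c, hc, hcmax⟩ := (f.support.filter (· ≤ x)).exists_max_image id
    ⟨a, Finset.mem_filter.mpr ⟨ha, hax⟩⟩
  obtain ⟨d, hd, hdmin⟩ := (f.support.filter (y ≤ ·)).exists_min_image id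
    ⟨b, Finset.mem_filter.mpr ⟨hb, hyb⟩⟩
  simp only [Finset.mem_filter, id, and_imp] at hc hcmax hd hdmin
  have := (maxGap_le_iff_s4 f _).mp le_rfl c hc.1 d hd.1 (by omega) fun z hz =>
    (hgap z hz).imp (hcmax z hz) (hdmin z hz)
  omega

theorem maxGap_add_le (A B : Polynomial ℤ) (hA : A ≠ 0) (hB : B ≠ 0)
    (hnc : (A + B).support = A.support ∪ B.support) :
    (maxGap (A + B) : ℤ) ≤
      max (max (maxGap A : ℤ) (maxGap B : ℤ))
        (max ((B.natTrailingDegree : ℤ) - A.natDegree)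
             ((A.natTrailingDegree : ℤ) - B.natDegree)) := by
  have key : maxGap (A + B) ≤ max (max (maxGap A) (maxGap B))
      (max (B.natTrailingDegree - A.natDegree) (A.natTrailingDegree - B.natDegree)) := by
    rw [maxGap_le_iff_s4, hnc]
    intro x hx y hy hxy hgap
    have hgA : ∀ z ∈ A.support, z ≤ x ∨ y ≤ z := fun z hz =>
      hgap z (Finset.mem_union_left _ hz)
    have hgB : ∀ z ∈ B.support, z ≤ x ∨ y ≤ z := fun z hz =>
      hgap z (Finset.mem_union_right _ hz)
    have hdA := natDegree_mem_support_of_nonzero hA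
    have hdB := natDegree_mem_support_of_nonzero hB
    have htA := natTrailingDegree_mem_support_of_nonzero hA
    have htB := natTrailingDegree_mem_support_of_nonzero hB
    have hx' : A.natTrailingDegree ≤ x ∨ B.natTrailingDegree ≤ x :=
      (Finset.mem_union.mp hx).imp
        (fun h => natTrailingDegree_le_of_mem_supp x h)
        (fun h => natTrailingDegree_le_of_mem_supp x h)
    have hy' : y ≤ A.natDegree ∨ y ≤ B.natDegree :=
      (Finset.mem_union.mp hy).imp
        (fun h => le_natDegree_of_mem_supp y h) (fun h => le_natDegree_of_mem_supp y h)
    have hA' := fun h₁ h₂ => le_add_maxGap hxy hgA htA h₁ hdA h₂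
    have hB' := fun h₁ h₂ => le_add_maxGap hxy hgB htB h₁ hdB h₂
    have := hgA _ hdA
    have := hgA _ htA
    have := hgB _ hdB
    have := hgB _ htB
    omega
  omega
end

section
/- Let p1 < p2 be odd primes. Then g(Φ_{p1p2}) ≤ p1 - 1. -/
open Polynomial

theorem List.foldr_max_zero_le {l : List ℕ} {m : ℕ} (h : ∀ x ∈ l, x ≤ m) :
    l.foldr max 0 ≤ m := by
  induction l with
  | nil => simp
  | cons a l ih => simp_all

theorem List.Pairwise.of_mem_zip_tail {l : List ℕ} (hl : l.Pairwise (· ≤ ·)) {a b : ℕ}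
    (h : (a, b) ∈ l.zip l.tail) : b ∈ l ∧ ∀ c ∈ l, c ≤ a ∨ b ≤ c := by
  induction l with
  | nil => simp at h
  | cons x l ih =>
    cases l with
    | nil => simp at h
    | cons y l =>
      simp only [List.tail_cons, List.zip_cons_cons, List.mem_cons, Prod.mk.injEq] at h
      rw [List.pairwise_cons] at hl
      rcases h with ⟨rfl, rfl⟩ | h
      · have := hl.2
        rw [List.pairwise_cons] at this
        grind
      · obtain ⟨hb, hc⟩ := ih hl.2 h
        have ha := hl.1 a (List.of_mem_zip h).1
        grind

/-- A polynomial has maximum gap at most `m` as soon as every exponent `b` of a nonzero term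
lying more than `m` above `a` is preceded by another exponent strictly between `a` and `b`. -/
theorem maxGap_le {f : ℤ[X]} {m : ℕ}
    (h : ∀ a b, a + m < b → (∀ c, a < c → c < b → f.coeff c = 0) → f.coeff b = 0) :
    maxGap f ≤ m := by
  refine List.foldr_max_zero_le fun x hx => ?_
  obtain ⟨⟨a, b⟩, hab, rfl⟩ := List.mem_map.1 hx
  obtain ⟨hb, hc⟩ := (f.support.pairwise_sort (· ≤ ·)).of_mem_zip_tail hab
  simp only [Finset.mem_sort, mem_support_iff] at hb hc
  by_contra hlt
  refine hb (h a b (by grind) fun c hac hcb => ?_)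
  by_contra hne
  have := hc c hne
  omega

/-- Membership in the numerical semigroup generated by `p` and `q`, with the multiplier of `q`
reduced modulo `p`. -/
def MemSemigroup (p q k : ℕ) : Prop := ∃ i, ∃ j < p, k = i * p + j * q

theorem MemSemigroup.add_left {p q k : ℕ} (h : MemSemigroup p q k) :
    MemSemigroup p q (k + p) := by
  obtain ⟨i, j, hj, rfl⟩ := h
  exact ⟨i + 1, j, hj, by ring⟩

theorem not_memSemigroup_of_add_eq_mul {p q k j : ℕ} (hpq : p.Coprime q) (hj : j < p)
    (h : k + p = j * q) : ¬ MemSemigroup p q k := by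
  rintro ⟨i, j', hj', rfl⟩
  have hmod : j' * q ≡ j * q [MOD p] := by
    rw [← h, show i * p + j' * q + p = j' * q + p * (i + 1) by ring]
    exact (Nat.modEq_iff_dvd' (by omega)).2 ⟨i + 1, by omega⟩
  have := (Nat.ModEq.cancel_right_of_coprime hpq hmod).eq_of_lt_of_lt hj' hj
  subst this
  have : 0 < p := by omega
  omega

open Classical in
/-- The generating series of the numerical semigroup generated by `p` and `q`. -/
noncomputable def semigroupSeries (p q : ℕ) : PowerSeries ℤ :=
  PowerSeries.mk fun k => if MemSemigroup p q k then 1 else 0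

open Classical in
theorem semigroupSeries_mul {p q : ℕ} (hpq : p.Coprime q) (hq : 0 < q) :
    semigroupSeries p q * (1 - PowerSeries.X ^ p) =
      ∑ j ∈ Finset.range p, (PowerSeries.X : PowerSeries ℤ) ^ (j * q) := by
  ext k
  have hsum : (∑ j ∈ Finset.range p, if k = j * q then (1 : ℤ) else 0) =
      if ∃ j < p, k = j * q then 1 else 0 := by
    split_ifs with h
    · obtain ⟨j, hj, rfl⟩ := h
      simp [hq.ne', hj]
    · push Not at h
      exact Finset.sum_eq_zero fun j hj => if_neg (h j (Finset.mem_range.1 hj))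
  rw [map_sum]
  simp only [PowerSeries.coeff_X_pow]
  rw [hsum, mul_sub, mul_one, map_sub, PowerSeries.coeff_mul_X_pow', semigroupSeries,
    PowerSeries.coeff_mk, PowerSeries.coeff_mk]
  by_cases hs : ∃ j < p, k = j * q
  · obtain ⟨j, hj, hk⟩ := hs
    have hmem : MemSemigroup p q k := ⟨0, j, hj, by omega⟩
    have hnot : p ≤ k → ¬ MemSemigroup p q (k - p) := fun hle =>
      not_memSemigroup_of_add_eq_mul hpq hj (by omega)
    have hs : ∃ j < p, k = j * q := ⟨j, hj, hk⟩
    by_cases hle : p ≤ k <;> simp [hmem, hle, hs, hnot]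
  · have hiff : MemSemigroup p q k ↔ p ≤ k ∧ MemSemigroup p q (k - p) := by
      constructor
      · rintro ⟨_ | i, j, hj, hk⟩
        · exact absurd ⟨j, hj, by omega⟩ hs
        · have hk' : k = p + (i * p + j * q) := by rw [hk]; ring
          exact ⟨by omega, i, j, hj, by omega⟩
      · rintro ⟨hle, h⟩
        simpa [Nat.sub_add_cancel hle] using h.add_left
    rw [if_neg hs, ← ite_and]
    simp [hiff]

theorem coe_cyclotomic_mul_eq {p q : ℕ} (hp : p.Prime) (hq : q.Prime) (hne : p ≠ q) :
    ((cyclotomic (p * q) ℤ : ℤ[X]) : PowerSeries ℤ) =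
      (1 - PowerSeries.X) * semigroupSeries p q := by
  have : Fact p.Prime := ⟨hp⟩
  have hpq := (Nat.coprime_primes hp hq).2 hne
  have hdvd : ¬ q ∣ p := fun h => hne ((Nat.prime_dvd_prime_iff_eq hq hp).1 h).symm
  have hexp := cyclotomic_expand_eq_cyclotomic_mul hq hdvd ℤ
  have hpoly : cyclotomic (p * q) ℤ * (1 - X ^ p) =
      (1 - X) * ∑ j ∈ Finset.range p, (X : ℤ[X]) ^ (j * q) := by
    have hgeom := cyclotomic_prime_mul_X_sub_one ℤ p
    have hsum : expand ℤ q (cyclotomic p ℤ) = ∑ j ∈ Finset.range p, (X : ℤ[X]) ^ (j * q) := by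
      simp [cyclotomic_prime, ← pow_mul, mul_comm]
    rw [← hsum, hexp]
    linear_combination cyclotomic (p * q) ℤ * hgeom
  have hseries := congrArg (Polynomial.coeToPowerSeries.ringHom (R := ℤ)) hpoly
  simp only [map_mul, map_sub, map_one, map_pow, map_sum,
    Polynomial.coeToPowerSeries.ringHom_apply, Polynomial.coe_X] at hseries
  rw [← semigroupSeries_mul hpq hq.pos, ← mul_assoc] at hseries
  refine mul_right_cancel₀ (fun h => ?_) hseries
  have := congrArg (PowerSeries.coeff 0) h
  simp [hp.ne_zero] at this

open Classical in
theorem coeff_succ_cyclotomic_mul {p q : ℕ} (hp : p.Prime) (hq : q.Prime) (hne : p ≠ q)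
    (k : ℕ) : (cyclotomic (p * q) ℤ).coeff (k + 1) =
      (if MemSemigroup p q (k + 1) then 1 else 0) - if MemSemigroup p q k then 1 else 0 := by
  rw [← Polynomial.coeff_coe, coe_cyclotomic_mul_eq hp hq hne, sub_mul, one_mul, map_sub,
    PowerSeries.coeff_succ_X_mul]
  simp [semigroupSeries]

theorem coeff_succ_cyclotomic_mul_eq_zero_iff {p q : ℕ} (hp : p.Prime) (hq : q.Prime)
    (hne : p ≠ q) (k : ℕ) : (cyclotomic (p * q) ℤ).coeff (k + 1) = 0 ↔
      (MemSemigroup p q (k + 1) ↔ MemSemigroup p q k) := by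
  classical
  rw [coeff_succ_cyclotomic_mul hp hq hne]
  split_ifs <;> simp_all

theorem maxGap_cyclotomic_two_primes_le (p1 p2 : ℕ) (hp1 : p1.Prime) (hp2 : p2.Prime)
    (hodd1 : Odd p1) (hodd2 : Odd p2) (hlt : p1 < p2) :
    maxGap (cyclotomic (p1 * p2) ℤ) ≤ p1 - 1 := by
  have hpos := hp1.pos
  refine maxGap_le fun a b hab hzero => ?_
  have hconst : ∀ d, a + d < b → (MemSemigroup p1 p2 (a + d) ↔ MemSemigroup p1 p2 a) := by
    intro d
    induction d with
    | zero => simp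
    | succ d ih =>
      intro hd
      rw [← ih (by omega)]
      exact (coeff_succ_cyclotomic_mul_eq_zero_iff hp1 hp2 hlt.ne (a + d)).1
        (hzero _ (by omega) hd)
  have hmem : ∀ k, a ≤ k → k < b → MemSemigroup p1 p2 k := by
    have ha : MemSemigroup p1 p2 a := by
      have hdiv := Nat.div_add_mod (a + p1 - 1) p1
      have hmod := Nat.mod_lt (a + p1 - 1) hpos
      set m := (a + p1 - 1) / p1
      refine (hconst (p1 * m - a) (by omega)).1 ⟨m, 0, hpos, ?_⟩
      rw [mul_comm m]
      omega
    intro k hak hkb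
    obtain ⟨d, rfl⟩ := Nat.exists_eq_add_of_le hak
    exact (hconst d hkb).2 ha
  obtain ⟨k, rfl⟩ := Nat.exists_eq_succ_of_ne_zero (show b ≠ 0 by omega)
  refine (coeff_succ_cyclotomic_mul_eq_zero_iff hp1 hp2 hlt.ne k).2
    (iff_of_true ?_ (hmem k (by omega) (by omega)))
  have := (hmem (k + 1 - p1) (by omega) (by omega)).add_left
  rwa [Nat.sub_add_cancel (by omega)] at this
end

section
/- Let n = p1·p2·p3 where p1 < p2 < p3 are odd primes. If 4(p1 - 1) ≤ p2 or p1² ≤ p3, then 2n/p1 > (4/3)·deg(Ψ_n) (i.e., 6·p2·p3 > 4·deg(Ψ_n)) or p2·(p1 - 1) < 2·p3, where deg(Ψ_n) = n - φ(n) and φ is Euler's totient. -/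
theorem cond_implies_D1_or_D2 (p1 p2 p3 n : ℕ)
    (hp1 : p1.Prime) (hp2 : p2.Prime) (hp3 : p3.Prime)
    (hodd1 : Odd p1) (hodd2 : Odd p2) (hodd3 : Odd p3)
    (h12 : p1 < p2) (h23 : p2 < p3) (hn : n = p1 * p2 * p3)
    (hcond : 4 * (p1 - 1) ≤ p2 ∨ p1 ^ 2 ≤ p3) :
    4 * (n - Nat.totient n) < 6 * p2 * p3 ∨ p2 * (p1 - 1) < 2 * p3 := by
  have htot : Nat.totient n = (p1 - 1) * (p2 - 1) * (p3 - 1) := by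
    have c12 := (Nat.coprime_primes hp1 hp2).2 h12.ne
    have c13 := (Nat.coprime_primes hp1 hp3).2 (h12.trans h23).ne
    have c23 := (Nat.coprime_primes hp2 hp3).2 h23.ne
    rw [hn, Nat.totient_mul (c13.mul_left c23), Nat.totient_mul c12,
      Nat.totient_prime hp1, Nat.totient_prime hp2, Nat.totient_prime hp3]
  rw [or_iff_not_imp_right, not_lt]
  intro hD2
  have h1 := hp1.two_le
  obtain ⟨a, rfl⟩ : ∃ a, p1 = a + 1 := ⟨p1 - 1, by omega⟩
  obtain ⟨b, rfl⟩ : ∃ b, p2 = b + 1 := ⟨p2 - 1, by omega⟩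
  obtain ⟨c, rfl⟩ : ∃ c, p3 = c + 1 := ⟨p3 - 1, by omega⟩
  simp only [Nat.add_sub_cancel] at *
  have ha : 1 ≤ a := by omega
  have hdeg : n - Nat.totient n = (b + 1) * (c + 1) + a * (b + c + 1) := by
    rw [htot, hn]
    apply Nat.sub_eq_of_eq_add
    ring
  rw [hdeg]
  suffices 2 * a * (b + c + 1) < (b + 1) * (c + 1) by linarith
  rcases hcond with h | h
  · calc 2 * a * (b + c + 1) < 4 * a * (c + 1) := by nlinarith
      _ ≤ (b + 1) * (c + 1) := Nat.mul_le_mul_right _ h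
  · have hb : 2 * a + 4 < b + 1 := by
      by_contra! hb
      nlinarith [Nat.mul_le_mul_right a hb]
    obtain ⟨u, rfl⟩ : ∃ u, b = 2 * a + 4 + u := ⟨b - (2 * a + 4), by omega⟩
    obtain ⟨v, rfl⟩ : ∃ v, c = a ^ 2 + 2 * a + v :=
      ⟨c - (a ^ 2 + 2 * a), by have : (a + 1) ^ 2 = a ^ 2 + 2 * a + 1 := by ring
                               omega⟩
    nlinarith [Nat.zero_le (u * v), Nat.zero_le (u * a ^ 2)]
end

section
/- Let n = p1·p2·p3 where p1 < p2 < p3 are odd primes. Then g(Ψ_n) ≤ max{ p1 - 1, deg(Ψ_n) - 2(p3 - (p1 - 1)) }, the right-hand side being computed in the integers. -/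
open Polynomial

theorem maxGap_le_of_forall_consecutive {f : ℤ[X]} {m : ℤ} (hm : 0 ≤ m)
    (h : ∀ a b, f.coeff a ≠ 0 → f.coeff b ≠ 0 → a < b →
      (∀ i, a < i → i < b → f.coeff i = 0) → (b : ℤ) - a ≤ m) :
    (maxGap f : ℤ) ≤ m := by
  have foldr_le : ∀ l : List ℕ, (∀ x ∈ l, (x : ℤ) ≤ m) → ((l.foldr max 0 : ℕ) : ℤ) ≤ m := by
    intro l hl
    induction l with
    | nil => simpa using hm
    | cons x l ih =>
      rw [List.foldr_cons, Nat.cast_max]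
      exact max_le (hl x (by simp)) (ih fun y hy => hl y (by simp [hy]))
  apply foldr_le
  intro x hx
  obtain ⟨⟨a, b⟩, hab, rfl⟩ := List.mem_map.1 hx
  obtain ⟨i, hi, hi'⟩ := List.mem_iff_getElem.1 hab
  have hsort : StrictMono (f.support.sort (· ≤ ·)).get := (Finset.sortedLT_sort _).strictMono_get
  rw [List.length_zip, List.length_tail] at hi
  rw [List.getElem_zip, List.getElem_tail, Prod.mk.injEq] at hi'
  obtain ⟨rfl, rfl⟩ := hi'
  have hlt : (f.support.sort (· ≤ ·))[i] < (f.support.sort (· ≤ ·))[i + 1] :=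
    @hsort ⟨i, by omega⟩ ⟨i + 1, by omega⟩ (by simp)
  have hmem : ∀ j (hj : j < (f.support.sort (· ≤ ·)).length),
      f.coeff (f.support.sort (· ≤ ·))[j] ≠ 0 := fun j hj =>
    mem_support_iff.1 ((Finset.mem_sort (· ≤ ·)).1 (List.getElem_mem hj))
  rw [Nat.cast_sub hlt.le]
  refine h _ _ (hmem _ _) (hmem _ _) hlt fun c h1 h2 => ?_
  by_contra hc
  obtain ⟨j, hj, rfl⟩ := List.mem_iff_getElem.1
    ((Finset.mem_sort (· ≤ ·)).2 (mem_support_iff.2 hc))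
  have h1' : i < j := hsort.lt_iff_lt (a := ⟨i, by omega⟩) (b := ⟨j, hj⟩) |>.1 h1
  have h2' : j < i + 1 := hsort.lt_iff_lt (a := ⟨j, hj⟩) (b := ⟨i + 1, by omega⟩) |>.1 h2
  omega

/-- If `f * (1 + X + ⋯ + X ^ (p - 1))` has nonnegative coefficients and `f(0) = f(1) = 1`, then
`p - 1` consecutive vanishing coefficients of `f` only occur beyond the degree of `f`. -/
theorem coeff_eq_zero_of_coeff_window_eq_zero {f : ℤ[X]} {p : ℕ} (hp : 0 < p)
    (h0 : f.coeff 0 = 1) (h1 : f.eval 1 = 1)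
    (hnonneg : ∀ m, 0 ≤ (f * ∑ i ∈ Finset.range p, X ^ i).coeff m) {a : ℕ}
    (ha : ∀ i, a < i → i < a + p → f.coeff i = 0) {i : ℕ} (hi : a < i) : f.coeff i = 0 := by
  set S : ℕ → ℤ := fun m => ∑ k ∈ Finset.range (m + 1), f.coeff k with hS
  have hsucc : ∀ m, S (m + 1) = S m + f.coeff (m + 1) := fun m => Finset.sum_range_succ _ _
  have hwin : ∀ m, (f * ∑ i ∈ Finset.range p, X ^ i).coeff (m + p) = S (m + p) - S m := by
    intro m
    rw [Finset.mul_sum, finsetSum_coeff, hS]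
    simp only
    rw [show m + p + 1 = (m + 1) + p by ring, Finset.sum_range_add, add_sub_cancel_left,
      ← Finset.sum_range_reflect]
    refine Finset.sum_congr rfl fun k hk => ?_
    rw [Finset.mem_range] at hk
    rw [coeff_mul_X_pow', if_pos (by omega)]
    congr 1
    omega
  have hstep : ∀ m, S m ≤ S (m + p) := fun m => by
    have := hnonneg (m + p)
    rw [hwin] at this
    linarith
  have hsteps : ∀ k m, S m ≤ S (m + k * p) := by
    intro k m
    induction k with
    | zero => simp
    | succ k ih => exact ih.trans ((hstep _).trans_eq (by congr 1; ring))
  have hle : ∀ m, S m ≤ 1 := fun m => by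
    refine (hsteps (f.natDegree) m).trans_eq ?_
    rw [← h1, eval_eq_sum_range' (n := m + f.natDegree * p + 1) (by nlinarith)]
    simp [hS]
  have hconst : ∀ j, j < p → S (a + j) = S a := by
    intro j hj
    induction j with
    | zero => rfl
    | succ j ih => rw [← add_assoc, hsucc, ih (by omega), ha _ (by omega) (by omega), add_zero]
  have hSa : 1 ≤ S a := by
    have hdiv := Nat.div_add_mod (a + (p - 1)) p
    have hmod := Nat.mod_lt (a + (p - 1)) hp
    rw [mul_comm] at hdiv
    obtain ⟨j, hj, hj'⟩ : ∃ j < p, a + j = (a + (p - 1)) / p * p :=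
      ⟨p - 1 - (a + (p - 1)) % p, by omega, by omega⟩
    rw [← hconst j hj, hj']
    simpa [hS, h0] using hsteps ((a + (p - 1)) / p) 0
  have hone : ∀ j, S (a + j) = 1 := by
    intro j
    refine le_antisymm (hle _) ?_
    have hdiv := Nat.div_add_mod j p
    rw [mul_comm] at hdiv
    calc 1 ≤ S a := hSa
      _ = S (a + j % p) := (hconst _ (Nat.mod_lt _ hp)).symm
      _ ≤ S (a + j % p + j / p * p) := hsteps _ _
      _ = S (a + j) := by congr 1; omega
  obtain ⟨j, rfl⟩ := Nat.exists_eq_add_of_lt hi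
  have := hsucc (a + j)
  rw [hone, add_assoc, hone] at this
  rw [add_assoc]
  linarith

theorem coeff_mul_expand {R : Type*} [CommSemiring R] (f g : R[X]) {q M : ℕ}
    (hM : g.natDegree < M) (i : ℕ) :
    (f * expand R q g).coeff i =
      ∑ k ∈ Finset.range M, if k * q ≤ i then g.coeff k * f.coeff (i - k * q) else 0 := by
  rw [expand_eq_sum, sum_over_range' _ (by simp) M hM, Finset.mul_sum, finsetSum_coeff]
  refine Finset.sum_congr rfl fun k _ => ?_
  rw [← pow_mul, mul_left_comm, coeff_C_mul, coeff_mul_X_pow', mul_ite, mul_zero, mul_comm q k]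

theorem coeff_mul_expand_of_lt {R : Type*} [CommSemiring R] (f g : R[X]) {q i : ℕ} (hi : i < q) :
    (f * expand R q g).coeff i = g.coeff 0 * f.coeff i := by
  rw [coeff_mul_expand f g (Nat.lt_succ_self _), Finset.sum_eq_single 0]
  · simp
  · intro k _ hk
    rw [if_neg]
    have : 1 * q ≤ k * q := Nat.mul_le_mul_right _ (by omega)
    omega
  · simp

theorem coeff_mul_expand_of_natDegree_lt {R : Type*} [CommSemiring R] (f g : R[X]) {q i : ℕ}
    (hi : f.natDegree + g.natDegree * q < i + q) (hi' : g.natDegree * q ≤ i) :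
    (f * expand R q g).coeff i = g.leadingCoeff * f.coeff (i - g.natDegree * q) := by
  rw [coeff_mul_expand f g (Nat.lt_succ_self _), Finset.sum_eq_single g.natDegree]
  · rw [if_pos hi', leadingCoeff]
  · intro k hk hk'
    rw [Finset.mem_range] at hk
    have : (k + 1) * q ≤ g.natDegree * q := Nat.mul_le_mul_right _ (by omega)
    rw [add_mul] at this
    rw [coeff_eq_zero_of_natDegree_lt (p := f) (by omega), mul_zero, ite_self]
  · simp

theorem coeff_mul_expand_mul {R : Type*} [CommSemiring R] (f g : R[X]) {q : ℕ}
    (hq : f.natDegree < q) (j : ℕ) :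
    (f * expand R q g).coeff (j * q) = g.coeff j * f.coeff 0 := by
  rw [coeff_mul_expand f g (M := g.natDegree + 1 + j) (by omega), Finset.sum_eq_single j]
  · simp
  · intro k _ hk
    split_ifs with h
    · rw [coeff_eq_zero_of_natDegree_lt (p := f), mul_zero]
      have hkj : k < j := lt_of_le_of_ne (Nat.le_of_mul_le_mul_right h (by omega)) hk
      have : (k + 1) * q ≤ j * q := Nat.mul_le_mul_right _ hkj
      rw [add_mul] at this
      omega
    · rfl
  · intro h
    rw [Finset.mem_range] at h
    rw [if_pos le_rfl, coeff_eq_zero_of_natDegree_lt (p := g) (by omega), zero_mul]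

theorem cyclotomic_mul_cyclotomic_prime {p q : ℕ} (hp : p.Prime) (hq : q.Prime) (hpq : p ≠ q) :
    cyclotomic (p * q) ℤ * cyclotomic p ℤ = expand ℤ q (cyclotomic p ℤ) :=
  (cyclotomic_expand_eq_cyclotomic_mul hq
    (fun h => hpq ((Nat.prime_dvd_prime_iff_eq hq hp).1 h).symm) ℤ).symm

theorem cyclotomic_mul_coeff_eq_zero {p q : ℕ} (hp : p.Prime) (hq : q.Prime) (hpq : p ≠ q) {a : ℕ}
    (ha : ∀ i, a < i → i < a + p → (cyclotomic (p * q) ℤ).coeff i = 0) {i : ℕ} (hi : a < i) :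
    (cyclotomic (p * q) ℤ).coeff i = 0 := by
  have hlt : 1 < p * q := by nlinarith [hp.two_le, hq.two_le]
  refine coeff_eq_zero_of_coeff_window_eq_zero hp.pos (cyclotomic_coeff_zero ℤ hlt) ?_ ?_ ha hi
  · refine eval_one_cyclotomic_not_prime_pow fun {r} hr k hk => hpq ?_
    rw [(Nat.prime_dvd_prime_iff_eq hp hr).1 (hp.dvd_of_dvd_pow (hk ▸ dvd_mul_right p q)),
      (Nat.prime_dvd_prime_iff_eq hq hr).1 (hq.dvd_of_dvd_pow (hk ▸ dvd_mul_left q p))]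
  · intro m
    have := Fact.mk hp
    rw [← cyclotomic_prime, cyclotomic_mul_cyclotomic_prime hp hq hpq, coeff_expand hq.pos]
    split_ifs
    · rw [cyclotomic_prime, finsetSum_coeff]
      exact Finset.sum_nonneg fun k _ => by rw [coeff_X_pow]; split_ifs <;> simp
    · rfl

theorem invCyclotomic_mul_mul {p q r : ℕ} (hp : p.Prime) (hq : q.Prime) (hr : r.Prime)
    (hpq : p ≠ q) (hpr : p ≠ r) (hqr : q ≠ r) :
    invCyclotomic (p * q * r) =
      cyclotomic (p * q) ℤ * expand ℤ r ((X ^ q - 1) * cyclotomic p ℤ) := by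
  have hdvd : ¬ r ∣ p * q := by
    rw [hr.dvd_mul, Nat.prime_dvd_prime_iff_eq hr hp, Nat.prime_dvd_prime_iff_eq hr hq]
    rintro (h | h)
    · exact hpr h.symm
    · exact hqr h.symm
  have := Fact.mk hp
  have key : cyclotomic (p * q * r) ℤ *
      (cyclotomic (p * q) ℤ * expand ℤ r ((X ^ q - 1) * cyclotomic p ℤ)) =
      X ^ (p * q * r) - 1 := by
    rw [← mul_assoc, ← cyclotomic_expand_eq_cyclotomic_mul hr hdvd, ← map_mul, mul_left_comm,
      cyclotomic_mul_cyclotomic_prime hp hq hpq,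
      show (X ^ q - 1 : ℤ[X]) = expand ℤ q (X - 1) by simp, ← map_mul, mul_comm (X - 1),
      cyclotomic_prime_mul_X_sub_one]
    simp only [map_sub, map_pow, expand_X, map_one]
    rw [← pow_mul, ← pow_mul]
    ring_nf
  rw [invCyclotomic, ← key, mul_divByMonic_cancel_left _ (cyclotomic.monic _ _)]

theorem coeff_X_pow_sub_one_mul_cyclotomic {p q : ℕ} (hp : p.Prime) (k : ℕ) :
    ((X ^ q - 1) * cyclotomic p ℤ).coeff k =
      (if q ≤ k ∧ k < q + p then 1 else 0) - if k < p then 1 else 0 := by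
  have := Fact.mk hp
  have hcoeff : ∀ m, (cyclotomic p ℤ).coeff m = if m < p then 1 else 0 := by
    intro m
    simp [cyclotomic_prime, coeff_X_pow]
  rw [sub_mul, one_mul, coeff_sub, coeff_X_pow_mul', hcoeff, hcoeff]
  congr 1
  grind

theorem maxGap_invCyclotomic_le_claim (p1 p2 p3 n : ℕ)
    (hp1 : p1.Prime) (hp2 : p2.Prime) (hp3 : p3.Prime)
    (hodd1 : Odd p1) (hodd2 : Odd p2) (hodd3 : Odd p3)
    (h12 : p1 < p2) (h23 : p2 < p3) (hn : n = p1 * p2 * p3) :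
    (maxGap (invCyclotomic n) : ℤ) ≤
      max ((p1 : ℤ) - 1)
        ((invCyclotomic n).natDegree - 2 * ((p3 : ℤ) - (p1 - 1))) := by
  have h1 := hp1.two_le
  rw [hn, invCyclotomic_mul_mul hp1 hp2 hp3 h12.ne (h12.trans h23).ne h23.ne]
  set f := cyclotomic (p1 * p2) ℤ with hf
  set g : ℤ[X] := (X ^ p2 - 1) * cyclotomic p1 ℤ with hg
  set N := p1 + p2 - 1 with hN
  set D := f.natDegree with hD
  have hf0 : f.coeff 0 = 1 := cyclotomic_coeff_zero ℤ (by nlinarith)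
  have hXmonic : (X ^ p2 - 1 : ℤ[X]).Monic := monic_X_pow_sub_C 1 hp2.ne_zero
  have hgmonic : g.Monic := hXmonic.mul (cyclotomic.monic _ _)
  have hgdeg : g.natDegree = N := by
    have hX : (X ^ p2 - 1 : ℤ[X]).natDegree = p2 := natDegree_X_pow_sub_C (r := (1 : ℤ))
    rw [hg, hXmonic.natDegree_mul (cyclotomic.monic _ _), hX, natDegree_cyclotomic,
      Nat.totient_prime hp1]
    omega
  have hgcoeff : ∀ k, g.coeff k = _ := coeff_X_pow_sub_one_mul_cyclotomic hp1
  have hdeg : (f * expand ℤ p3 g).natDegree = D + N * p3 := by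
    rw [(cyclotomic.monic _ _).natDegree_mul (hgmonic.expand hp3.pos), natDegree_expand, hgdeg]
  rw [hdeg]
  apply maxGap_le_of_forall_consecutive
  · exact le_max_of_le_left (by omega)
  intro a b ha hb hab hgap
  have hbdeg : b ≤ D + N * p3 := hdeg ▸ le_natDegree_of_ne_zero hb
  rcases le_or_gt p3 D with hle | hlt
  · by_contra! hcon
    obtain ⟨hcon1, hcon2⟩ := max_lt_iff.1 hcon
    have hlow : p3 ≤ a + (p1 - 1) := by
      by_contra! h
      have hz : f.coeff D = 0 := by
        refine cyclotomic_mul_coeff_eq_zero hp1 hp2 h12.ne (a := a) (fun i hi hi' => ?_) (by omega)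
        have := hgap i hi (by omega)
        rw [coeff_mul_expand_of_lt _ _ (by omega), hgcoeff, if_neg (by omega),
          if_pos hp1.pos] at this
        simpa using this
      rw [hD, coeff_natDegree, (cyclotomic.monic _ _).leadingCoeff] at hz
      exact one_ne_zero hz
    have hhigh : b + p3 ≤ D + N * p3 + (p1 - 1) := by
      by_contra! h
      have hcoeff : ∀ i, N * p3 + D < i + p3 → (f * expand ℤ p3 g).coeff i =
          f.coeff (i - N * p3) := by
        intro i hi
        rw [coeff_mul_expand_of_natDegree_lt f g (by rw [hgdeg]; omega) (by rw [hgdeg]; omega),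
          hgmonic.leadingCoeff, one_mul, hgdeg]
      rw [hcoeff b (by omega)] at hb
      refine hb (cyclotomic_mul_coeff_eq_zero hp1 hp2 h12.ne (a := b - N * p3 - p1)
        (fun i hi hi' => ?_) (by omega))
      have := hgap (i + N * p3) (by omega) (by omega)
      rwa [hcoeff _ (by omega), Nat.add_sub_cancel] at this
    omega
  · refine le_max_of_le_right ?_
    have hmul : ∀ j, (j < p1 ∨ p2 ≤ j ∧ j ≤ N) → a < j * p3 → b ≤ j * p3 := by
      intro j hj haj
      by_contra! h
      have := hgap _ haj h
      rw [coeff_mul_expand_mul f g hlt, hgcoeff, hf0] at this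
      grind
    have hNz : (N : ℤ) = p1 + p2 - 1 := by omega
    have hdiv := Nat.div_add_mod a p3
    have hmod := Nat.mod_lt a hp3.pos
    set j := a / p3
    rw [mul_comm] at hdiv
    have hp3z : (0 : ℤ) ≤ p3 := by positivity
    have hwide : (p3 : ℤ) ≤ (D + N * p3 : ℕ) - 2 * ((p3 : ℤ) - (p1 - 1)) := by
      have : (0 : ℤ) ≤ (p1 + p2 - 4) * p3 := mul_nonneg (by omega) hp3z
      push_cast
      rw [hNz]
      linarith [show (2 : ℤ) ≤ p1 by omega, show (0 : ℤ) ≤ D by omega]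
    by_cases hj : j + 1 < p1 ∨ p2 ≤ j + 1 ∧ j + 1 ≤ N
    · have := hmul (j + 1) hj (by rw [add_mul]; omega)
      rw [add_mul] at this
      omega
    · rcases lt_or_ge (j + 1) p2 with hj' | hj'
      · have hjp : (j + 1) * p3 ≤ p2 * p3 := Nat.mul_le_mul_right _ hj'.le
        rw [add_mul] at hjp
        have hbp : (b : ℤ) ≤ p2 * p3 := by exact_mod_cast hmul p2 (by omega) (by omega)
        have hap : ((p1 : ℤ) - 1) * p3 ≤ a := by
          have : ((p1 : ℤ) - 1) * p3 ≤ j * p3 := mul_le_mul_of_nonneg_right (by omega) hp3z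
          have : (j : ℤ) * p3 ≤ a := by exact_mod_cast (by omega : j * p3 ≤ a)
          linarith
        have : (0 : ℤ) ≤ (p1 - 2) * p3 := mul_nonneg (by omega) hp3z
        push_cast
        rw [hNz]
        linarith [show (2 : ℤ) ≤ p1 by omega, show (0 : ℤ) ≤ D by omega]
      · have hja : N * p3 ≤ j * p3 := Nat.mul_le_mul_right _ (by omega)
        omega
end

section
/- Let n > 1 be an odd positive integer. Then g(Ψ_{2n}) = max{ g(Ψ_n), deg(Φ_n) }, i.e., the maximum gap of Ψ_{2n} equals the maximum of the maximum gap of Ψ_n and φ(n), where φ is Euler's totient. -/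
open Polynomial

namespace List

/-- The largest truncated difference of consecutive entries of a list. -/
def maxConsecutiveSub (l : List ℕ) : ℕ :=
  ((l.zip l.tail).map fun p => p.2 - p.1).foldr max 0

theorem maxConsecutiveSub_cons_cons (a b : ℕ) (l : List ℕ) :
    maxConsecutiveSub (a :: b :: l) = max (b - a) (maxConsecutiveSub (b :: l)) := rfl

theorem maxConsecutiveSub_singleton (a : ℕ) : maxConsecutiveSub [a] = 0 := rfl

theorem maxConsecutiveSub_append (l m : List ℕ) (a b : ℕ) :
    maxConsecutiveSub (l ++ [a] ++ b :: m) =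
      max (maxConsecutiveSub (l ++ [a])) (max (b - a) (maxConsecutiveSub (b :: m))) := by
  induction l with
  | nil => simp [maxConsecutiveSub_cons_cons, maxConsecutiveSub_singleton]
  | cons c l ih =>
    cases l with
    | nil => simp [maxConsecutiveSub_cons_cons, maxConsecutiveSub_singleton]
    | cons e l =>
      simp only [List.cons_append, maxConsecutiveSub_cons_cons] at ih ⊢
      rw [ih, max_assoc]

theorem maxConsecutiveSub_map_add_right (l : List ℕ) (n : ℕ) :
    maxConsecutiveSub (l.map (· + n)) = maxConsecutiveSub l := by
  induction l with
  | nil => rfl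
  | cons a l ih =>
    cases l with
    | nil => rfl
    | cons b l =>
      simp only [List.map_cons, maxConsecutiveSub_cons_cons] at ih ⊢
      rw [ih, Nat.add_sub_add_right]

end List

theorem maxGap_eq_maxConsecutiveSub (f : ℤ[X]) :
    maxGap f = f.support.sort.maxConsecutiveSub := rfl

namespace Finset

theorem sort_union_of_lt {α : Type*} [LinearOrder α] {s t : Finset α}
    (h : ∀ a ∈ s, ∀ b ∈ t, a < b) : (s ∪ t).sort = s.sort ++ t.sort := by
  have hd : (s.sort ++ t.sort).Nodup := by
    rw [List.nodup_append]
    exact ⟨sort_nodup _ _, sort_nodup _ _, fun a ha b hb =>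
      (h a ((mem_sort _).1 ha) b ((mem_sort _).1 hb)).ne⟩
  have hs : (s.sort ++ t.sort).Pairwise (· ≤ ·) := by
    rw [List.pairwise_append]
    exact ⟨pairwise_sort _ _, pairwise_sort _ _, fun a ha b hb =>
      (h a ((mem_sort _).1 ha) b ((mem_sort _).1 hb)).le⟩
  rw [← (List.toFinset_sort (· ≤ ·) hd).2 hs]
  simp

theorem maxConsecutiveSub_sort_union_map {s : Finset ℕ} {d n : ℕ} (h0 : 0 ∈ s) (hd : d ∈ s)
    (hle : ∀ a ∈ s, a ≤ d) (hdn : d < n) :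
    (s ∪ s.map (addRightEmbedding n)).sort.maxConsecutiveSub =
      max s.sort.maxConsecutiveSub (n - d) := by
  have hunion : (s ∪ s.map (addRightEmbedding n)).sort = s.sort ++ s.sort.map (· + n) := by
    rw [sort_union_of_lt]
    · congr 1
      exact (StrictMonoOn.map_finsetSort (f := addRightEmbedding n) s
        fun a _ b _ hab => Nat.add_lt_add_right hab n).symm
    · intro a ha b hb
      obtain ⟨c, -, rfl⟩ := mem_map.1 hb
      have := hle a ha
      simp only [addRightEmbedding_apply]
      omega
  have hlast : s.sort = (s.erase d).sort ++ [d] := by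
    have := sort_union_of_lt (s := s.erase d) (t := {d}) fun a ha b hb => by
      rw [mem_singleton.1 hb]
      exact lt_of_le_of_ne (hle a (mem_of_mem_erase ha)) (ne_of_mem_erase ha)
    rwa [union_comm, ← insert_eq, insert_erase hd, sort_singleton] at this
  have hhead : s.sort = 0 :: (s.erase 0).sort := by
    conv_lhs => rw [← insert_erase h0]
    exact sort_insert _ (fun _ _ => Nat.zero_le _) (notMem_erase _ _)
  have key := List.maxConsecutiveSub_append (s.erase d).sort
    ((s.erase 0).sort.map (· + n)) d n
  have htail : n :: (s.erase 0).sort.map (· + n) = s.sort.map (· + n) := by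
    simp [hhead]
  rw [hunion]
  rw [htail, ← hlast, List.maxConsecutiveSub_map_add_right] at key
  rw [key]
  omega

end Finset

namespace Polynomial

theorem support_comp_neg_X {R : Type*} [CommRing R] (f : R[X]) :
    (f.comp (-X)).support = f.support := by
  ext k
  have h : (-X : R[X]) = C (-1) * X := by simp
  rw [mem_support_iff, mem_support_iff, h, comp_C_mul_X_coeff, ne_eq, ne_eq,
    (isUnit_one.neg.pow k).mul_left_eq_zero]

theorem support_X_pow_sub_one_mul {R : Type*} [Ring R] {f : R[X]} {n : ℕ}
    (h : f.natDegree < n) :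
    ((X ^ n - 1) * f).support = f.support ∪ f.support.map (addRightEmbedding n) := by
  ext k
  simp only [mem_support_iff, sub_mul, one_mul, coeff_sub, coeff_X_pow_mul', Finset.mem_union,
    Finset.mem_map, addRightEmbedding_apply]
  split_ifs with hk
  · have : f.coeff k = 0 := coeff_eq_zero_of_natDegree_lt (h.trans_le hk)
    rw [this, sub_zero]
    constructor
    · exact fun hc => Or.inr ⟨_, hc, Nat.sub_add_cancel hk⟩
    · rintro (hc | ⟨c, hc, rfl⟩)
      · exact absurd rfl hc
      · simpa using hc
  · rw [zero_sub, neg_ne_zero]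
    constructor
    · exact Or.inl
    · rintro (hc | ⟨c, -, rfl⟩)
      · exact hc
      · omega

/-- `Φ₂ₙ(x) = Φₙ(-x)` for odd `n > 1`. -/
theorem cyclotomic_two_mul_of_odd {n : ℕ} (hn : 1 < n) (hodd : Odd n) :
    cyclotomic (2 * n) ℤ = (cyclotomic n ℤ).comp (-X) := by
  have hn2 : 2 < n := by obtain ⟨k, rfl⟩ := hodd; omega
  have hζ := Complex.isPrimitiveRoot_exp n (by omega)
  set ζ := Complex.exp (2 * Real.pi * Complex.I / n)
  have hnegζ : IsPrimitiveRoot (-ζ) (2 * n) := by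
    convert! IsPrimitiveRoot.orderOf (-ζ)
    rw [neg_eq_neg_one_mul, (Commute.all _ _).orderOf_mul_eq_mul_orderOf_of_coprime]
    · simp [hζ.eq_orderOf]
    · simp [← hζ.eq_orderOf, hodd]
  have hnat : ((cyclotomic n ℤ).comp (-X)).natDegree = n.totient := by
    rw [natDegree_comp, natDegree_neg, natDegree_X, mul_one, natDegree_cyclotomic]
  have hmonic : ((cyclotomic n ℤ).comp (-X)).Monic := by
    rw [Monic, leadingCoeff_comp (by simp), (cyclotomic.monic n ℤ).leadingCoeff,
      natDegree_cyclotomic, leadingCoeff_neg, leadingCoeff_X, (Nat.totient_even hn2).neg_one_pow,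
      one_mul]
  refine (eq_of_monic_of_dvd_of_natDegree_le (cyclotomic.monic _ ℤ) hmonic ?_ ?_).symm
  · rw [cyclotomic_eq_minpoly hnegζ (by omega)]
    refine minpoly.isIntegrallyClosed_dvd (hnegζ.isIntegral (by omega)) ?_
    rw [aeval_comp, map_neg, aeval_X, neg_neg, cyclotomic_eq_minpoly hζ (by omega)]
    exact minpoly.aeval ℤ ζ
  · rw [hnat, natDegree_cyclotomic, Nat.totient_two_mul_of_odd hodd]

end Polynomial

/-- `Ψ₂ₙ(x) = -(xⁿ - 1)Ψₙ(-x)` for odd `n > 1`. -/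
theorem invCyclotomic_two_mul {n : ℕ} (hn : 1 < n) (hodd : Odd n) :
    invCyclotomic (2 * n) = -((X ^ n - 1) * (invCyclotomic n).comp (-X)) := by
  refine mul_left_cancel₀ (cyclotomic_ne_zero (2 * n) ℤ) ?_
  have h := congrArg (fun p => p.comp (-X)) (cyclotomic_mul_invCyclotomic n)
  simp only [mul_comp, sub_comp, pow_comp, X_comp, one_comp, hodd.neg_pow,
    ← cyclotomic_two_mul_of_odd hn hodd] at h
  rw [cyclotomic_mul_invCyclotomic]
  linear_combination (X ^ n - 1) * h

theorem coeff_zero_invCyclotomic {n : ℕ} (hn : 1 < n) : (invCyclotomic n).coeff 0 = -1 := by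
  have h := congrArg (fun p => p.coeff 0) (cyclotomic_mul_invCyclotomic n)
  rw [mul_coeff_zero, cyclotomic_coeff_zero ℤ hn, one_mul, coeff_sub, coeff_X_pow,
    if_neg (by omega), coeff_one_zero, zero_sub] at h
  exact h

theorem maxGap_invCyclotomic_two_mul (n : ℕ) (hn : 1 < n) (hodd : Odd n) :
    maxGap (invCyclotomic (2 * n)) =
      max (maxGap (invCyclotomic n)) (cyclotomic n ℤ).natDegree := by
  have hpos : 0 < n.totient := Nat.totient_pos.2 (by omega)
  have hle := Nat.totient_le n
  have hdeg := natDegree_invCyclotomic n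
  have hcoeff := coeff_zero_invCyclotomic hn
  have hne : invCyclotomic n ≠ 0 := by
    intro h
    simp [h] at hcoeff
  rw [maxGap_eq_maxConsecutiveSub, maxGap_eq_maxConsecutiveSub, invCyclotomic_two_mul hn hodd,
    support_neg, support_X_pow_sub_one_mul, support_comp_neg_X,
    Finset.maxConsecutiveSub_sort_union_map (d := n - n.totient) (by simp [hcoeff]) _
      (fun a ha => hdeg ▸ le_natDegree_of_mem_supp a ha) (by omega),
    natDegree_cyclotomic, Nat.sub_sub_self hle]
  · rw [← hdeg]
    exact natDegree_mem_support_of_nonzero hne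
  · rw [natDegree_comp, natDegree_neg, natDegree_X, mul_one, hdeg]
    omega
end

section
/- Let p1 < p2 be odd primes. Then Ψ_{p1p2}(x) = -(1 + x + ... + x^{p1-1}) + (x^{p2} + x^{p2+1} + ... + x^{p2+p1-1}), and consequently g(Ψ_{p1p2}) = p2 - (p1 - 1). -/
open Polynomial

theorem invCyclotomic_mul_of_prime {p q : ℕ} (hp : p.Prime) (hq : q.Prime) (hpq : p ≠ q) :
    invCyclotomic (p * q) = (∑ i ∈ Finset.range p, X ^ i) * (X ^ q - 1) := by
  have : Fact p.Prime := ⟨hp⟩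
  have hdvd : ¬q ∣ p := fun h => hpq ((Nat.prime_dvd_prime_iff_eq hq hp).1 h).symm
  have hexp := cyclotomic_expand_eq_cyclotomic_mul hq hdvd ℤ
  have hgeom := congrArg (expand ℤ q) (cyclotomic_prime_mul_X_sub_one ℤ p)
  simp only [map_mul, map_sub, map_pow, expand_X, map_one, ← pow_mul] at hgeom
  rw [← cyclotomic_prime ℤ p, invCyclotomic, mul_comm p q, ← hgeom, hexp, mul_assoc, mul_comm q p,
    mul_divByMonic_cancel_left _ (cyclotomic.monic _ _)]

theorem foldr_max_gaps_range' (b m : ℕ) :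
    (((List.range' b (m + 1)).zip (List.range' b (m + 1)).tail).map
      (fun p => p.2 - p.1)).foldr max 0 ≤ 1 := by
  induction m generalizing b with
  | zero => simp
  | succ m ih =>
    have := ih (b + 1)
    simp only [List.range'_succ, List.tail_cons, List.zip_cons_cons, List.map_cons,
      List.foldr_cons] at this ⊢
    omega

theorem foldr_max_gaps_range'_append (a b n m : ℕ) (hab : a + n < b) :
    (((List.range' a (n + 1) ++ List.range' b (m + 1)).zip
      (List.range' a (n + 1) ++ List.range' b (m + 1)).tail).map
      (fun p => p.2 - p.1)).foldr max 0 = b - (a + n) := by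
  induction n generalizing a with
  | zero =>
    have := foldr_max_gaps_range' b m
    simp only [List.range'_succ, List.range'_zero, List.cons_append, List.nil_append,
      List.tail_cons, List.zip_cons_cons, List.map_cons, List.foldr_cons] at this ⊢
    omega
  | succ n ih =>
    have := ih (a + 1) (by omega)
    simp only [List.range'_succ, List.cons_append,
      List.tail_cons, List.zip_cons_cons, List.map_cons, List.foldr_cons] at this ⊢
    omega

theorem sort_support_neg_sum_add_sum {p q : ℕ} (hpq : p ≤ q) :
    (-(∑ i ∈ Finset.range p, X ^ i) + ∑ i ∈ Finset.range p, X ^ (q + i) : ℤ[X]).support.sort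
      (· ≤ ·) = List.range' 0 p ++ List.range' q p := by
  have hsupp : (-(∑ i ∈ Finset.range p, X ^ i) +
      ∑ i ∈ Finset.range p, X ^ (q + i) : ℤ[X]).support =
      (List.range' 0 p ++ List.range' q p).toFinset := by
    ext k
    have hsum : ∑ i ∈ Finset.range p, (if k = q + i then (1 : ℤ) else 0) =
        if q ≤ k ∧ k < q + p then 1 else 0 := by
      split_ifs with h
      · rw [Finset.sum_eq_single (k - q)]
        · rw [if_pos (by omega)]
        · intro i _ hi
          rw [if_neg (by omega)]
        · intro hk
          simp only [Finset.mem_range] at hk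
          omega
      · refine Finset.sum_eq_zero fun i hi => if_neg ?_
        simp only [Finset.mem_range] at hi
        omega
    simp only [mem_support_iff, coeff_add, coeff_neg, finsetSum_coeff, coeff_X_pow, hsum,
      Finset.sum_ite_eq, Finset.mem_range, List.mem_toFinset, List.mem_append, List.mem_range'_1]
    split_ifs <;> simp <;> omega
  have hlt : (List.range' 0 p ++ List.range' q p).Pairwise (· < ·) := by
    simp only [List.pairwise_append, List.mem_range'_1]
    exact ⟨List.pairwise_lt_range', List.pairwise_lt_range', by omega⟩
  rw [hsupp, List.toFinset_sort _ (hlt.imp Nat.ne_of_lt)]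
  exact hlt.imp Nat.le_of_lt

theorem invCyclotomic_two_primes (p1 p2 : ℕ) (hp1 : p1.Prime) (hp2 : p2.Prime)
    (hodd1 : Odd p1) (hodd2 : Odd p2) (hlt : p1 < p2) :
    invCyclotomic (p1 * p2) =
        -(∑ i ∈ Finset.range p1, X ^ i) + ∑ i ∈ Finset.range p1, X ^ (p2 + i) ∧
      maxGap (invCyclotomic (p1 * p2)) = p2 - (p1 - 1) := by
  have hform : invCyclotomic (p1 * p2) =
      -(∑ i ∈ Finset.range p1, X ^ i) + ∑ i ∈ Finset.range p1, X ^ (p2 + i) := by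
    simp only [invCyclotomic_mul_of_prime hp1 hp2 hlt.ne, pow_add, ← Finset.mul_sum]
    ring
  refine ⟨hform, ?_⟩
  rw [hform, maxGap, sort_support_neg_sum_add_sum hlt.le]
  obtain ⟨n, rfl⟩ := Nat.exists_eq_add_one_of_ne_zero hp1.ne_zero
  rw [foldr_max_gaps_range'_append 0 p2 n n (by omega)]
  omega
end

section
/- Let p1 < p2 be odd primes. Then the cyclotomic polynomial Φ_{p1p2} has the form 1 - x + x^{p1} + (terms of degree higher than p1); that is, its coefficient of x^0 is 1, its coefficient of x^1 is -1, its coefficient of x^k is 0 for all 1 < k < p1, and its coefficient of x^{p1} is 1. -/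
open Polynomial

/-- Below degree `q`, the coefficients of `Φ_{pq}` are those of `(1 - X) * Φ_q(X ^ p)`. -/
theorem coeff_cyclotomic_mul_prime_of_lt {p q k : ℕ} (hp : p.Prime) (hq : q.Prime)
    (hpq : ¬ p ∣ q) (hk : k < q) :
    (cyclotomic (p * q) ℤ).coeff k = ((1 - X) * expand ℤ p (cyclotomic q ℤ)).coeff k := by
  have : Fact q.Prime := ⟨hq⟩
  have h : (1 - X) * expand ℤ p (cyclotomic q ℤ) =
      cyclotomic (p * q) ℤ - cyclotomic (p * q) ℤ * X ^ q := by
    rw [cyclotomic_expand_eq_cyclotomic_mul hp hpq, mul_comm q p]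
    linear_combination (-cyclotomic (p * q) ℤ) * cyclotomic_prime_mul_X_sub_one ℤ q
  rw [h, coeff_sub, coeff_mul_X_pow', if_neg (by omega), sub_zero]

theorem coeff_expand_cyclotomic_prime_of_le {p q k : ℕ} (hp : 1 < p) (hq : q.Prime)
    (hk : k ≤ p) :
    (expand ℤ p (cyclotomic q ℤ)).coeff k = if k = 0 ∨ k = p then 1 else 0 := by
  have : Fact q.Prime := ⟨hq⟩
  have hq1 := hq.one_lt
  rw [coeff_expand (by omega)]
  rcases Nat.eq_zero_or_pos k with rfl | hk0
  · simp [cyclotomic_coeff_zero ℤ hq1]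
  rcases hk.eq_or_lt with rfl | hlt
  · simp [Nat.div_self hk0, cyclotomic_prime, finsetSum_coeff, coeff_X_pow, hq1]
  · rw [if_neg (Nat.not_dvd_of_pos_of_lt hk0 hlt), if_neg (by omega)]

theorem cyclotomic_two_primes_initial_form (p1 p2 : ℕ)
    (hp1 : p1.Prime) (hp2 : p2.Prime)
    (hodd1 : Odd p1) (hodd2 : Odd p2) (hlt : p1 < p2) :
    (cyclotomic (p1 * p2) ℤ).coeff 0 = 1 ∧
      (cyclotomic (p1 * p2) ℤ).coeff 1 = -1 ∧
      (∀ k, 1 < k → k < p1 → (cyclotomic (p1 * p2) ℤ).coeff k = 0) ∧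
      (cyclotomic (p1 * p2) ℤ).coeff p1 = 1 := by
  have h2 : 2 < p1 := by
    have := hp1.two_le
    obtain ⟨m, hm⟩ := hodd1
    omega
  have hndvd : ¬ p1 ∣ p2 := fun h => hlt.ne ((Nat.prime_dvd_prime_iff_eq hp1 hp2).1 h)
  have succ_coeff (k : ℕ) (hk : k + 1 ≤ p1) : (cyclotomic (p1 * p2) ℤ).coeff (k + 1) =
      (if k + 1 = 0 ∨ k + 1 = p1 then 1 else 0) - if k = 0 ∨ k = p1 then 1 else 0 := by
    rw [coeff_cyclotomic_mul_prime_of_lt hp1 hp2 hndvd (by omega), sub_mul, one_mul, coeff_sub,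
      coeff_X_mul, coeff_expand_cyclotomic_prime_of_le (by omega) hp2 hk,
      coeff_expand_cyclotomic_prime_of_le (by omega) hp2 (by omega)]
  refine ⟨cyclotomic_coeff_zero ℤ (one_lt_mul'' hp1.one_lt hp2.one_lt), ?_, fun k hk1 hk => ?_, ?_⟩
  · rw [succ_coeff 0 (by omega), if_neg (by omega), if_pos (by omega), zero_sub]
  · obtain ⟨k, rfl⟩ := Nat.exists_eq_add_of_lt hk1
    rw [succ_coeff (1 + k) (by omega), if_neg (by omega), if_neg (by omega), sub_zero]
  · obtain ⟨m, rfl⟩ := Nat.exists_eq_add_of_lt h2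
    rw [succ_coeff (2 + m) (by omega), if_pos (by omega), if_neg (by omega), sub_zero]
end
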